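/- Let H be a separable infinite-dimensional real Hilbert space and set p₀ = (1, 0) ∈ ℋ(H). Let ρ : O₊(B) → O₊(B) be any irreducible group homomorphism, i.e. the only closed linear subspaces N ⊆ ℝ × H with ρ(g)(N) ⊆ N for all g ∈ O₊(B) are {0} and ℝ × H (no continuity of ρ is assumed). Then there exist a unique t with 0 < t ≤ 1 and a point p ∈ ℋ(H) such that B(ρ(g)·p, ρ(h)·p) = ( B(g·p₀, h·p₀) )^t, equivalently cosh d(ρ(g)p, ρ(h)p) = (cosh d(g p₀, h p₀))^t, for all g, h ∈ O₊(B). -/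

import Mathlib

open scoped RealInnerProductSpace

variable (H : Type*) [NormedAddCommGroup H] [InnerProductSpace ℝ H]

/-- The Minkowski bilinear form on `ℝ × H`. -/
noncomputable def minkB (v w : ℝ × H) : ℝ := v.1 * w.1 - ⟪v.2, w.2⟫

/-- The hyperboloid model of hyperbolic space inside `ℝ × H`. -/
noncomputable def Hyp : Set (ℝ × H) := {v | minkB H v v = 1 ∧ 0 < v.1}

/-- Inverse hyperbolic cosine. -/
noncomputable def arcosh (x : ℝ) : ℝ := Real.log (x + Real.sqrt (x ^ 2 - 1))

/-- The hyperbolic distance on the hyperboloid. -/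
noncomputable def hypDist (x y : ℝ × H) : ℝ := arcosh (minkB H x y)

/-- A subset of the hyperboloid is hyperbolically total if its closed linear span
is all of `ℝ × H`. -/
def HypTotal (S : Set (ℝ × H)) : Prop :=
  (Submodule.span ℝ S).topologicalClosure = ⊤

/-- A kernel of hyperbolic type. -/
def IsHypKernel {X : Type*} (β : X → X → ℝ) : Prop :=
  (∀ x y, β x y = β y x) ∧ (∀ x y, 0 ≤ β x y) ∧ (∀ x, β x x = 1) ∧
    ∀ (n : ℕ) (x₀ : X) (x : Fin n → X) (c : Fin n → ℝ),
      ∑ i, ∑ j, c i * c j * β (x i) (x j) ≤ (∑ k, c k * β (x k) x₀) ^ 2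

/-- A kernel of conditionally negative type. -/
def IsCNDKernel {X : Type*} (ψ : X → X → ℝ) : Prop :=
  (∀ x y, ψ x y = ψ y x) ∧ (∀ x, ψ x x = 0) ∧
    ∀ (n : ℕ) (x : Fin n → X) (c : Fin n → ℝ), (∑ i, c i = 0) →
      ∑ i, ∑ j, c i * c j * ψ (x i) (x j) ≤ 0

/-- The group `O₊(B)` of continuous linear automorphisms of `ℝ × H` preserving the
Minkowski form and the upper hyperboloid sheet. -/
noncomputable def Oplus : Subgroup ((ℝ × H) ≃L[ℝ] (ℝ × H)) where
  carrier := {g | (∀ v w, minkB H (g v) (g w) = minkB H v w) ∧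
    ∀ v, v ∈ Hyp H ↔ g v ∈ Hyp H}
  one_mem' := ⟨fun _ _ => rfl, fun _ => Iff.rfl⟩
  mul_mem' := by
    rintro a b ⟨ha1, ha2⟩ ⟨hb1, hb2⟩
    refine ⟨fun v w => ?_, fun v => ?_⟩
    · show minkB H (a (b v)) (a (b w)) = _
      rw [ha1, hb1]
    · show v ∈ Hyp H ↔ a (b v) ∈ Hyp H
      rw [← ha2, ← hb2]
  inv_mem' := by
    rintro a ⟨ha1, ha2⟩
    refine ⟨fun v w => ?_, fun v => ?_⟩
    · show minkB H (a.symm v) (a.symm w) = minkB H v w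
      conv_rhs => rw [← a.apply_symm_apply v, ← a.apply_symm_apply w, ha1]
    · show v ∈ Hyp H ↔ a.symm v ∈ Hyp H
      conv_lhs => rw [← a.apply_symm_apply v, ← ha2]

section HilbertSpace

variable {E : Type*} [NormedAddCommGroup E] [InnerProductSpace ℝ E]

theorem exists_unit_mem_orthogonal_finset (W : Submodule ℝ E) (hW : ¬ FiniteDimensional ℝ W)
    (S : Finset E) : ∃ w ∈ W, ‖w‖ = 1 ∧ ∀ s ∈ S, ⟪s, w⟫ = 0 := by
  obtain ⟨w, hwW, hw0, hw⟩ : ∃ w ∈ W, w ≠ 0 ∧ ∀ s ∈ S, ⟪s, w⟫ = 0 := by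
    by_contra! hcon
    apply hW
    let φ : W →ₗ[ℝ] (S → ℝ) :=
      LinearMap.pi fun s => (innerSL ℝ (s : E)).toLinearMap.comp W.subtype
    refine FiniteDimensional.of_injective φ ?_
    rw [← LinearMap.ker_eq_bot, LinearMap.ker_eq_bot']
    intro m hm
    by_contra hne
    obtain ⟨s, hs, hs'⟩ := hcon m m.2 (by simpa using hne)
    exact hs' (congrFun hm ⟨s, hs⟩)
  refine ⟨‖w‖⁻¹ • w, W.smul_mem _ hwW, norm_smul_inv_norm hw0, fun s hs => ?_⟩
  rw [inner_smul_right, hw s hs, mul_zero]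

theorem Orthonormal.countable_index [TopologicalSpace.SeparableSpace E] {κ : Type*} {f : κ → E}
    (hf : Orthonormal ℝ f) : Countable κ := by
  have hd : Pairwise (Function.onFun Disjoint fun i => Metric.ball (f i) (1 / 2)) := by
    intro i j hij
    apply Metric.ball_disjoint_ball
    rw [dist_eq_norm]
    have h2 : ‖f i - f j‖ ^ 2 = 2 := by
      rw [norm_sub_sq_real, hf.1 i, hf.1 j, hf.2 hij]; norm_num
    nlinarith [norm_nonneg (f i - f j)]
  exact Set.countable_univ_iff.mp <| Set.PairwiseDisjoint.countable_of_isOpen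
    (s := fun i => Metric.ball (f i) (1 / 2)) (a := Set.univ) (hd.set_pairwise _)
    (fun _ _ => Metric.isOpen_ball) (fun i _ => ⟨f i, Metric.mem_ball_self (by norm_num)⟩)

theorem infinite_of_hilbertBasis {κ : Type*} (hE : ¬ FiniteDimensional ℝ E)
    (b : HilbertBasis κ ℝ E) : Infinite κ := by
  by_contra hfin
  rw [not_infinite_iff_finite] at hfin
  have := Fintype.ofFinite κ
  exact hE b.toOrthonormalBasis.toBasis.finiteDimensional_of_finite

theorem exists_hilbertBasis_of_countable [CompleteSpace E] [TopologicalSpace.SeparableSpace E]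
    (hE : ¬ FiniteDimensional ℝ E) (κ : Type*) [Countable κ] [Infinite κ] :
    Nonempty (HilbertBasis κ ℝ E) := by
  obtain ⟨w, b, -⟩ := exists_hilbertBasis ℝ E
  have := infinite_of_hilbertBasis hE b
  have := b.orthonormal.countable_index
  obtain ⟨e⟩ := nonempty_equiv_of_countable (α := κ) (β := w)
  have ho : Orthonormal ℝ (b ∘ e) := b.orthonormal.comp _ e.injective
  refine ⟨HilbertBasis.mk ho ?_⟩
  rw [e.surjective.range_comp, b.dense_span]

theorem Orthonormal.sumElim {κ κ' : Type*} {f : κ → E} {f' : κ' → E} (hf : Orthonormal ℝ f)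
    (hf' : Orthonormal ℝ f') (h : ∀ i j, ⟪f i, f' j⟫ = 0) : Orthonormal ℝ (Sum.elim f f') := by
  constructor
  · rintro (i | i)
    · exact hf.1 i
    · exact hf'.1 i
  · rintro (i | i) (j | j) hij
    · exact hf.2 (by simpa using hij)
    · exact h i j
    · rw [real_inner_comm]; exact h j i
    · exact hf'.2 (by simpa using hij)

theorem mem_orthogonal_span_range_iff {κ : Type*} {f : κ → E} {w : E} :
    w ∈ (Submodule.span ℝ (Set.range f))ᗮ ↔ ∀ i, ⟪f i, w⟫ = 0 := by
  rw [Submodule.mem_orthogonal]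
  refine ⟨fun h i => h _ (Submodule.subset_span ⟨i, rfl⟩), fun h x hx => ?_⟩
  induction hx using Submodule.span_induction with
  | mem x hx => obtain ⟨i, rfl⟩ := hx; exact h i
  | zero => simp
  | add x y _ _ hx hy => rw [inner_add_left, hx, hy, add_zero]
  | smul a x _ hx => rw [inner_smul_left, hx, mul_zero]

theorem Orthonormal.not_finiteDimensional {u : ℕ → E} (hu : Orthonormal ℝ u) {W : Submodule ℝ E}
    (hW : ∀ n, u n ∈ W) : ¬ FiniteDimensional ℝ W := by
  intro hfd
  have hli : LinearIndependent ℝ (fun n => (⟨u n, hW n⟩ : W)) :=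
    LinearIndependent.of_comp W.subtype hu.linearIndependent
  have := hli.finite
  exact not_finite ℕ

/-- The unitary equivalence matching two Hilbert bases with the same index set. -/
theorem exists_linearIsometryEquiv_hilbertBasis {F : Type*} [NormedAddCommGroup F]
    [InnerProductSpace ℝ F] {κ : Type*} (b : HilbertBasis κ ℝ E) (c : HilbertBasis κ ℝ F) :
    ∃ v : E ≃ₗᵢ[ℝ] F, ∀ i, v (b i) = c i := by
  classical
  refine ⟨b.repr.trans c.repr.symm, fun i => ?_⟩
  rw [LinearIsometryEquiv.trans_apply, b.repr_self, c.repr_symm_single]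

theorem Orthonormal.exists_hilbertBasis_sum [CompleteSpace E]
    [TopologicalSpace.SeparableSpace E] {κ : Type*}
    {f : κ → E} (hf : Orthonormal ℝ f) {u : ℕ → E} (hu : Orthonormal ℝ u)
    (hfu : ∀ i j, ⟪f i, u j⟫ = 0) :
    ∃ b : HilbertBasis (κ ⊕ ℕ) ℝ E, ∀ i, b (Sum.inl i) = f i := by
  set W : Submodule ℝ E := (Submodule.span ℝ (Set.range f))ᗮ with hWdef
  have memW : ∀ w : E, w ∈ W ↔ ∀ i, ⟪f i, w⟫ = 0 := fun w => mem_orthogonal_span_range_iff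
  obtain ⟨c⟩ := exists_hilbertBasis_of_countable
    (hu.not_finiteDimensional fun j => (memW _).2 fun i => hfu i j) ℕ
  have hc : Orthonormal ℝ (fun n => (c n : E)) :=
    c.orthonormal.comp_linearIsometry W.subtypeₗᵢ
  have ho : Orthonormal ℝ (Sum.elim f fun n => (c n : E)) :=
    hf.sumElim hc fun i j => (memW _).1 (c j).2 i
  have hbot : (Submodule.span ℝ (Set.range (Sum.elim f fun n => (c n : E))))ᗮ = ⊥ := by
    rw [eq_bot_iff]
    intro w hw
    rw [Submodule.mem_orthogonal] at hw
    have hwW : w ∈ W := (memW _).2 fun i => hw _ (Submodule.subset_span ⟨Sum.inl i, rfl⟩)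
    have h0 : c.repr ⟨w, hwW⟩ = 0 := by
      ext n
      rw [c.repr_apply_apply]
      exact hw _ (Submodule.subset_span ⟨Sum.inr n, rfl⟩)
    have : (⟨w, hwW⟩ : W) = 0 := by simpa using h0
    simpa using congrArg Subtype.val this
  exact ⟨HilbertBasis.mkOfOrthogonalEqBot ho hbot, fun i => by
    rw [HilbertBasis.coe_mkOfOrthogonalEqBot]; rfl⟩

/-- Two orthonormal families of infinite codimension are conjugate by an orthogonal operator. -/
theorem Orthonormal.exists_linearIsometryEquiv_apply_eq [CompleteSpace E]
    [TopologicalSpace.SeparableSpace E]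
    {κ : Type*} {f f' : κ → E} (hf : Orthonormal ℝ f) (hf' : Orthonormal ℝ f')
    {u u' : ℕ → E} (hu : Orthonormal ℝ u) (hu' : Orthonormal ℝ u')
    (hfu : ∀ i j, ⟪f i, u j⟫ = 0) (hfu' : ∀ i j, ⟪f' i, u' j⟫ = 0) :
    ∃ v : E ≃ₗᵢ[ℝ] E, ∀ i, v (f i) = f' i := by
  obtain ⟨b, hb⟩ := hf.exists_hilbertBasis_sum hu hfu
  obtain ⟨b', hb'⟩ := hf'.exists_hilbertBasis_sum hu' hfu'
  obtain ⟨v, hv⟩ := exists_linearIsometryEquiv_hilbertBasis b b'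
  exact ⟨v, fun i => by rw [← hb, hv, hb']⟩

end HilbertSpace

section Swindle

/-- A length function on a group, applied to the diagonal elements of a wreath product over
`ℕ × ℤ`, is bounded on each factor. -/
theorem exists_bound_mulSingle {Γ G : Type*} [Group Γ] [Group G] (D : (ℕ × ℤ → Γ) →* G)
    (hD : ∀ σ : Equiv.Perm (ℕ × ℤ), ∃ s : G, ∀ a, s * D a * s⁻¹ = D (a ∘ σ))
    (ℓ : G → ℝ) (hmul : ∀ g h, ℓ (g * h) ≤ ℓ g + ℓ h) (hinv : ∀ g, ℓ g⁻¹ = ℓ g) :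
    ∃ C, ∀ g : Γ, ℓ (D (Pi.mulSingle (0, 0) g)) ≤ C := by
  obtain ⟨n, hn⟩ : ∃ n : ℕ, ∀ b : ℤ → Γ, ∃ a, (∀ z, a (n, z) = b z) ∧ ℓ (D a) ≤ n := by
    by_contra! hcon
    choose b hb using hcon
    obtain ⟨n, hn⟩ := exists_nat_gt (ℓ (D fun i => b i.1 i.2))
    exact (hb n (fun i => b i.1 i.2) fun z => rfl).not_gt hn
  let σ : Equiv.Perm (ℕ × ℤ) :=
    { toFun := fun i => (i.1, if i.1 = n then i.2 - 1 else i.2)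
      invFun := fun i => (i.1, if i.1 = n then i.2 + 1 else i.2)
      left_inv := by rintro ⟨m, z⟩; by_cases h : m = n <;> simp [h]
      right_inv := by rintro ⟨m, z⟩; by_cases h : m = n <;> simp [h] }
  obtain ⟨s, hs⟩ := hD σ
  obtain ⟨t, ht⟩ := hD (Equiv.swap (0, 0) (n, 0))
  refine ⟨2 * n + 2 * ℓ s + 2 * ℓ t, fun g => ?_⟩
  obtain ⟨a, ha, hla⟩ := hn fun z => if 0 ≤ z then g else 1
  have hcomm : D a * (s * D a * s⁻¹)⁻¹ = D (Pi.mulSingle (n, 0) g) := by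
    rw [hs, ← map_inv, ← map_mul]
    congr 1
    ext ⟨m, z⟩
    by_cases hm : m = n
    · subst hm
      simp only [Pi.mul_apply, Pi.inv_apply, Function.comp_apply, σ, Equiv.coe_fn_mk, ha, if_true]
      by_cases hz : z = 0
      · subst hz; simp
      · rw [Pi.mulSingle_eq_of_ne (by simpa using hz)]
        by_cases h0 : 0 ≤ z
        · rw [if_pos h0, if_pos (by lia), mul_inv_cancel]
        · rw [if_neg h0, if_neg (by lia), mul_inv_cancel]
    · rw [Pi.mulSingle_eq_of_ne (by simp [hm])]
      simp [σ, hm]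
  have hconj : t * D (Pi.mulSingle (n, 0) g) * t⁻¹ = D (Pi.mulSingle (0, 0) g) := by
    rw [ht]
    congr 1
    ext i
    by_cases hi : i = (0, 0)
    · subst hi; simp
    · rw [Pi.mulSingle_eq_of_ne hi, Function.comp_apply, Pi.mulSingle_eq_of_ne]
      rw [Ne, Equiv.swap_apply_eq_iff, Equiv.swap_apply_right]
      exact hi
  rw [← hconj, ← hcomm]
  have h1 := hmul (t * (D a * (s * D a * s⁻¹)⁻¹)) t⁻¹
  have h2 := hmul t (D a * (s * D a * s⁻¹)⁻¹)
  have h3 := hmul (D a) (s * D a * s⁻¹)⁻¹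
  have h4 := hmul (s * D a) s⁻¹
  have h5 := hmul s (D a)
  rw [hinv] at h1 h3 h4
  linarith

end Swindle

section MonomialOperators

variable {E : Type*} [NormedAddCommGroup E] [InnerProductSpace ℝ E] {ι : Type*}

theorem memℓp_two_monomial (a : ι → E ≃ₗᵢ[ℝ] E) (σ : Equiv.Perm ι) (f : lp (fun _ : ι => E) 2) :
    Memℓp (fun i => a i (f (σ i))) 2 := by
  have hf := lp.memℓp f
  rw [memℓp_gen_iff (by norm_num)] at hf ⊢
  simpa [Function.comp_def] using
    (σ.summable_iff (f := fun i => ‖f i‖ ^ (2 : ENNReal).toReal)).2 hf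

theorem inner_lp_single_eq_inner_coord [DecidableEq ι] (i : ι) (v : E)
    (f : lp (fun _ : ι => E) 2) : ⟪(lp.single 2 i v : lp (fun _ : ι => E) 2), f⟫ = ⟪v, f i⟫ :=
  lp.inner_single_left i v f

/-- The operator `f ↦ (i ↦ a i (f (σ i)))` on `ℓ²(ι, E)`. -/
noncomputable def lpMonomial (a : ι → E ≃ₗᵢ[ℝ] E) (σ : Equiv.Perm ι) :
    lp (fun _ : ι => E) 2 ≃ₗᵢ[ℝ] lp (fun _ : ι => E) 2 where
  toFun f := ⟨fun i => a i (f (σ i)), memℓp_two_monomial a σ f⟩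
  invFun f := ⟨fun i => (a (σ.symm i)).symm (f (σ.symm i)),
    memℓp_two_monomial (fun i => (a (σ.symm i)).symm) σ.symm f⟩
  map_add' f g := by ext i; exact map_add (a i) _ _
  map_smul' c f := by ext i; exact map_smul (a i) c _
  left_inv f := by ext i; simp
  right_inv f := by ext i; simp
  norm_map' f := by
    rw [lp.norm_eq_tsum_rpow (by norm_num), lp.norm_eq_tsum_rpow (by norm_num)]
    congr 1
    simpa using σ.tsum_eq (fun i => ‖f i‖ ^ (2 : ENNReal).toReal)

/-- Diagonal operators on `ℓ²(ι, E)`. -/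
noncomputable def lpDiagonal :
    (ι → E ≃ₗᵢ[ℝ] E) →* (lp (fun _ : ι => E) 2 ≃ₗᵢ[ℝ] lp (fun _ : ι => E) 2) where
  toFun a := lpMonomial a 1
  map_one' := by ext f i; rfl
  map_mul' a b := by ext f i; rfl

@[simp]
theorem lpDiagonal_apply (a : ι → E ≃ₗᵢ[ℝ] E) (f : lp (fun _ : ι => E) 2)
    (i : ι) : lpDiagonal a f i = a i (f i) := rfl

theorem exists_conj_lpDiagonal (σ : Equiv.Perm ι) :
    ∃ s : lp (fun _ : ι => E) 2 ≃ₗᵢ[ℝ] lp (fun _ : ι => E) 2,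
      ∀ a, s * lpDiagonal a * s⁻¹ = lpDiagonal (a ∘ σ) := by
  refine ⟨lpMonomial 1 σ, fun a => ?_⟩
  rw [mul_inv_eq_iff_eq_mul]
  ext f i
  rfl

/-- An orthogonal operator of `ℓ²(ι, E)` fixing all blocks except one is diagonal. -/
theorem exists_eq_lpDiagonal_mulSingle [DecidableEq ι] (i₀ : ι) {κ : Type*}
    (b : HilbertBasis κ ℝ E) (k : lp (fun _ : ι => E) 2 ≃ₗᵢ[ℝ] lp (fun _ : ι => E) 2)
    (hk : ∀ i, i ≠ i₀ → ∀ m, k (lp.single 2 i (b m)) = lp.single 2 i (b m)) :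
    ∃ g, k = lpDiagonal (Pi.mulSingle i₀ g) := by
  have coord : ∀ k : lp (fun _ : ι => E) 2 ≃ₗᵢ[ℝ] lp (fun _ : ι => E) 2,
      (∀ i, i ≠ i₀ → ∀ m, k (lp.single 2 i (b m)) = lp.single 2 i (b m)) →
      ∀ f, ∀ i, i ≠ i₀ → k f i = f i := by
    intro k hk f i hi
    refine b.repr.injective (lp.ext (funext fun m => ?_))
    rw [b.repr_apply_apply, b.repr_apply_apply]
    refine (inner_lp_single_eq_inner_coord i (b m) _).symm.trans ?_
    refine Eq.trans ?_ (inner_lp_single_eq_inner_coord i (b m) _)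
    rw [← hk i hi m, k.inner_map_map, hk i hi m]
  have hk' : ∀ i, i ≠ i₀ → ∀ m, k.symm (lp.single 2 i (b m)) = lp.single 2 i (b m) := by
    intro i hi v
    rw [LinearIsometryEquiv.symm_apply_eq, hk i hi v]
  have block : ∀ k : lp (fun _ : ι => E) 2 ≃ₗᵢ[ℝ] lp (fun _ : ι => E) 2,
      (∀ i, i ≠ i₀ → ∀ m, k (lp.single 2 i (b m)) = lp.single 2 i (b m)) →
      ∀ v, lp.single 2 i₀ (k (lp.single 2 i₀ v) i₀) = k (lp.single 2 i₀ v) := by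
    intro k hk v
    ext i
    by_cases hi : i = i₀
    · subst hi; rw [lp.single_apply_self]
    · rw [lp.single_apply_ne _ _ _ hi, coord k hk _ i hi, lp.single_apply_ne _ _ _ hi]
  let g : E ≃ₗᵢ[ℝ] E :=
    { toFun := fun v => k (lp.single 2 i₀ v) i₀
      invFun := fun v => k.symm (lp.single 2 i₀ v) i₀
      map_add' := fun v w => by rw [lp.single_add, map_add]; rfl
      map_smul' := fun c v => by rw [lp.single_smul, map_smul]; rfl
      left_inv := fun v => by
        show k.symm (lp.single 2 i₀ (k (lp.single 2 i₀ v) i₀)) i₀ = v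
        rw [block k hk, k.symm_apply_apply, lp.single_apply_self]
      right_inv := fun v => by
        show k (lp.single 2 i₀ (k.symm (lp.single 2 i₀ v) i₀)) i₀ = v
        rw [block k.symm hk', k.apply_symm_apply, lp.single_apply_self]
      norm_map' := fun v => by
        show ‖k (lp.single 2 i₀ v) i₀‖ = ‖v‖
        rw [← lp.norm_single (E := fun _ : ι => E) (p := 2) (by norm_num) i₀, block k hk,
          k.norm_map, lp.norm_single (by norm_num)] }
  refine ⟨g, ?_⟩
  ext f i
  rw [lpDiagonal_apply]
  by_cases hi : i = i₀
  · subst hi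
    rw [Pi.mulSingle_eq_same]
    show k f i = k (lp.single 2 i (f i)) i
    refine ext_inner_left (E := E) ℝ fun v => ?_
    refine (inner_lp_single_eq_inner_coord i v _).symm.trans ?_
    refine Eq.trans ?_ (inner_lp_single_eq_inner_coord i v _)
    rw [← k.symm.inner_map_map,
      ← k.symm.inner_map_map _ (k (lp.single 2 i (f i))), k.symm_apply_apply, k.symm_apply_apply,
      ← block k.symm hk', inner_lp_single_eq_inner_coord, inner_lp_single_eq_inner_coord,
        lp.single_apply_self]
  · rw [Pi.mulSingle_eq_of_ne hi, coord k hk f i hi]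
    rfl

theorem nonempty_hilbertBasis_lp {κ : Type*} (b : HilbertBasis κ ℝ E) [CompleteSpace E]
    [DecidableEq ι] : ∃ c : HilbertBasis (ι × κ) ℝ (lp (fun _ : ι => E) 2),
      ∀ i m, c (i, m) = lp.single 2 i (b m) := by
  classical
  have ho : Orthonormal ℝ fun q : ι × κ => (lp.single 2 q.1 (b q.2) : lp (fun _ : ι => E) 2) := by
    rw [orthonormal_iff_ite]
    rintro ⟨i, m⟩ ⟨j, n⟩
    rw [lp.inner_single_left]
    have hb := orthonormal_iff_ite.1 b.orthonormal m n
    by_cases hij : i = j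
    · subst hij
      rw [lp.single_apply_self, hb]
      simp
    · rw [lp.single_apply_ne _ _ _ hij, inner_zero_right, if_neg (by simp [hij])]
  have hbot : (Submodule.span ℝ (Set.range
      fun q : ι × κ => (lp.single 2 q.1 (b q.2) : lp (fun _ : ι => E) 2)))ᗮ = ⊥ := by
    rw [eq_bot_iff]
    intro f hf
    rw [Submodule.mem_orthogonal] at hf
    rw [Submodule.mem_bot]
    ext i
    show f i = 0
    have h0 : b.repr (f i) = 0 := by
      ext m
      rw [b.repr_apply_apply]
      refine (inner_lp_single_eq_inner_coord i (b m) f).symm.trans ?_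
      exact hf _ (Submodule.subset_span ⟨(i, m), rfl⟩)
    simpa using h0
  exact ⟨HilbertBasis.mkOfOrthogonalEqBot ho hbot, fun i m => by
    rw [HilbertBasis.coe_mkOfOrthogonalEqBot]⟩

end MonomialOperators

section BoundedLength

variable {E : Type*} [NormedAddCommGroup E] [InnerProductSpace ℝ E] [CompleteSpace E]
  [TopologicalSpace.SeparableSpace E]

/-- Length functions on the orthogonal group are bounded on the pointwise stabilizers of
orthonormal sequences. -/
theorem exists_bound_of_fixes_orthonormal (hE : ¬ FiniteDimensional ℝ E)
    (ℓ : (E ≃ₗᵢ[ℝ] E) → ℝ) (hmul : ∀ g h, ℓ (g * h) ≤ ℓ g + ℓ h) (hinv : ∀ g, ℓ g⁻¹ = ℓ g)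
    {x u : ℕ → E} (hx : Orthonormal ℝ x) (hu : Orthonormal ℝ u) (hxu : ∀ i j, ⟪x i, u j⟫ = 0) :
    ∃ C, ∀ k : E ≃ₗᵢ[ℝ] E, (∀ n, k (x n) = x n) → ℓ k ≤ C := by
  obtain ⟨b⟩ := exists_hilbertBasis_of_countable hE ℕ
  obtain ⟨b'⟩ := exists_hilbertBasis_of_countable hE ((ℕ × ℤ) × ℕ)
  obtain ⟨c, hc⟩ := nonempty_hilbertBasis_lp (ι := ℕ × ℤ) b
  obtain ⟨T, hT⟩ := exists_linearIsometryEquiv_hilbertBasis b' c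
  obtain ⟨C, hC⟩ := exists_bound_mulSingle (lpDiagonal (E := E) (ι := ℕ × ℤ))
    exists_conj_lpDiagonal (fun g => ℓ ((T.trans g).trans T.symm))
    (fun g h => by
      have : (T.trans (g * h)).trans T.symm
          = ((T.trans g).trans T.symm) * ((T.trans h).trans T.symm) := by
        ext v; simp
      rw [this]; exact hmul _ _)
    (fun g => by
      have : (T.trans g⁻¹).trans T.symm = ((T.trans g).trans T.symm)⁻¹ := by
        rw [eq_inv_iff_mul_eq_one]
        ext v; simp
      rw [this]; exact hinv _)
  have hinf : Infinite {q : (ℕ × ℤ) × ℕ // q.1 ≠ (0, 0)} :=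
    Infinite.of_injective (fun n : ℕ => ⟨((n + 1, 0), 0), by simp⟩) fun m n h => by simpa using h
  obtain ⟨ε⟩ := nonempty_equiv_of_countable (α := ℕ) (β := {q : (ℕ × ℤ) × ℕ // q.1 ≠ (0, 0)})
  have hx₀ : Orthonormal ℝ fun n => b' (ε n) :=
    b'.orthonormal.comp (fun n => (ε n : (ℕ × ℤ) × ℕ)) (Subtype.val_injective.comp ε.injective)
  have hu₀ : Orthonormal ℝ fun n => b' ((0, 0), n) :=
    b'.orthonormal.comp (fun n => (((0, 0), n) : (ℕ × ℤ) × ℕ)) fun m n h => by simpa using h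
  obtain ⟨v, hv⟩ := hx.exists_linearIsometryEquiv_apply_eq hx₀ hu hu₀ hxu fun i j =>
    b'.orthonormal.2 fun h => (ε i).2 (by rw [h])
  refine ⟨C + 2 * ℓ v, fun k hk => ?_⟩
  set k₀ : E ≃ₗᵢ[ℝ] E := v * k * v⁻¹ with hk₀
  have hfix : ∀ q : (ℕ × ℤ) × ℕ, q.1 ≠ (0, 0) → k₀ (b' q) = b' q := by
    intro q hq
    obtain ⟨n, hn⟩ := ε.surjective ⟨q, hq⟩
    have hq' : b' q = v (x n) := by rw [hv, hn]
    have hvv : v⁻¹ (v (x n)) = x n := v.symm_apply_apply _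
    rw [hq', hk₀]
    show v (k (v⁻¹ (v (x n)))) = _
    rw [hvv, hk]
  obtain ⟨g, hg⟩ := exists_eq_lpDiagonal_mulSingle (0, 0) b ((T.symm.trans k₀).trans T) (by
    intro i hi m
    rw [← hc, ← hT]
    simp [hfix (i, m) hi])
  have hb := hC g
  rw [← hg] at hb
  have : (T.trans ((T.symm.trans k₀).trans T)).trans T.symm = k₀ := by ext v; simp
  rw [this] at hb
  have hk' : k = v⁻¹ * (k₀ * v) := by rw [hk₀]; group
  have h1 := hmul v⁻¹ (k₀ * v)
  have h2 := hmul k₀ v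
  rw [hinv] at h1
  rw [hk']
  linarith

/-- Every length function on the orthogonal group of a separable infinite-dimensional real Hilbert
space is bounded. -/
theorem exists_bound_length (hE : ¬ FiniteDimensional ℝ E)
    (ℓ : (E ≃ₗᵢ[ℝ] E) → ℝ) (hmul : ∀ g h, ℓ (g * h) ≤ ℓ g + ℓ h) (hinv : ∀ g, ℓ g⁻¹ = ℓ g) :
    ∃ C, ∀ g, ℓ g ≤ C := by
  classical
  obtain ⟨x, z, u, hx, hz, hu, hxz, hxu, hzu⟩ : ∃ x z u : ℕ → E, Orthonormal ℝ x ∧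
      Orthonormal ℝ z ∧ Orthonormal ℝ u ∧ (∀ i j, ⟪x i, z j⟫ = 0) ∧ (∀ i j, ⟪x i, u j⟫ = 0) ∧
      ∀ i j, ⟪z i, u j⟫ = 0 := by
    obtain ⟨b⟩ := exists_hilbertBasis_of_countable hE ℕ
    have sub : ∀ p q : ℕ, p ≠ 0 → Orthonormal ℝ fun n => b (p * n + q) := fun p q hp =>
      b.orthonormal.comp (fun n => p * n + q) fun m n h => by simpa [hp] using h
    exact ⟨_, _, _, sub 2 0 (by norm_num), sub 4 1 (by norm_num), sub 4 3 (by norm_num),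
      fun i j => b.orthonormal.2 (by lia), fun i j => b.orthonormal.2 (by lia),
      fun i j => b.orthonormal.2 (by lia)⟩
  obtain ⟨C₁, hC₁⟩ := exists_bound_of_fixes_orthonormal hE ℓ hmul hinv hx hu hxu
  obtain ⟨C₂, hC₂⟩ := exists_bound_of_fixes_orthonormal hE ℓ hmul hinv hz hu hzu
  have bound : ∀ (k : E ≃ₗᵢ[ℝ] E) (s s' : ℕ → E), Orthonormal ℝ s → Orthonormal ℝ s' →
      (∀ i j, ⟪x i, s j⟫ = 0) → (∀ i j, ⟪x i, s' j⟫ = 0) → (∀ i j, ⟪s i, s' j⟫ = 0) →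
      (∀ n, k (s n) = s n) → ℓ k ≤ C₂ + 2 * C₁ := by
    intro k s s' hs hs' hxs hxs' hss' hk
    obtain ⟨v, hv⟩ := (hx.sumElim hs hxs).exists_linearIsometryEquiv_apply_eq
      (hx.sumElim hz hxz) hs' hu
      (by rintro (i | i) j; exacts [hxs' i j, hss' i j])
      (by rintro (i | i) j; exacts [hxu i j, hzu i j])
    have hv1 : ℓ v ≤ C₁ := hC₁ v fun n => hv (Sum.inl n)
    have hk1 : ℓ (v * k * v⁻¹) ≤ C₂ := by
      refine hC₂ _ fun n => ?_
      have hz' : z n = v (s n) := (hv (Sum.inr n)).symm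
      have hvv : v⁻¹ (v (s n)) = s n := v.symm_apply_apply _
      rw [hz']
      show v (k (v⁻¹ (v (s n)))) = _
      rw [hvv, hk]
    have hk' : k = v⁻¹ * ((v * k * v⁻¹) * v) := by group
    have h1 := hmul v⁻¹ ((v * k * v⁻¹) * v)
    have h2 := hmul (v * k * v⁻¹) v
    rw [hinv] at h1
    rw [hk']
    linarith
  refine ⟨(C₂ + 2 * C₁) + (C₂ + 2 * C₁), fun g => ?_⟩
  set W : Submodule ℝ E := (Submodule.span ℝ (Set.range x))ᗮ with hWdef
  have memW : ∀ w : E, w ∈ W ↔ ∀ i, ⟪x i, w⟫ = 0 := fun w => mem_orthogonal_span_range_iff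
  have hWinf : ¬ FiniteDimensional ℝ W :=
    hu.not_finiteDimensional fun j => (memW _).2 fun i => hxu i j
  obtain ⟨y, hyW, hy⟩ := exists_seq_of_forall_finset_exists (fun w => w ∈ W ∧ ‖w‖ = 1)
    (fun w w' => ⟪w, w'⟫ = 0 ∧ ⟪g w, w'⟫ = 0 ∧ ⟪g.symm w, w'⟫ = 0) (by
      intro S _
      obtain ⟨w, hw, hw1, hwS⟩ := exists_unit_mem_orthogonal_finset W hWinf
        (S ∪ S.image g ∪ S.image g.symm)
      refine ⟨w, ⟨hw, hw1⟩, fun s hs => ⟨hwS _ ?_, hwS _ ?_, hwS _ ?_⟩⟩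
      · simp [hs]
      · exact Finset.mem_union_left _ (Finset.mem_union_right _ (Finset.mem_image_of_mem _ hs))
      · exact Finset.mem_union_right _ (Finset.mem_image_of_mem _ hs))
  have hyo : Orthonormal ℝ y := by
    refine ⟨fun n => (hyW n).2, fun i j hij => ?_⟩
    rcases lt_or_gt_of_ne hij with h | h
    · exact (hy i j h).1
    · rw [real_inner_comm]; exact (hy j i h).1
  have hgy : ∀ i j, i ≠ j → ⟪y i, g (y j)⟫ = 0 := by
    intro i j hij
    rcases lt_or_gt_of_ne hij with h | h
    · rw [← g.symm.inner_map_map, g.symm_apply_apply]; exact (hy i j h).2.2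
    · rw [real_inner_comm]; exact (hy j i h).2.1
  have hsub : ∀ q : ℕ, Orthonormal ℝ fun n => y (3 * n + q) := fun q =>
    hyo.comp (fun n => 3 * n + q) fun m n h => by simpa using h
  have hxy : ∀ i j, ⟪x i, y j⟫ = 0 := fun i j => (memW _).1 (hyW j).1 i
  have hgo : Orthonormal ℝ fun n => g (y (3 * n + 0)) := (hsub 0).comp_linearIsometryEquiv g
  obtain ⟨h, hh⟩ := ((hsub 1).sumElim (hsub 0)
      fun i j => hyo.2 (by lia)).exists_linearIsometryEquiv_apply_eq
    ((hsub 1).sumElim hgo fun i j => hgy _ _ (by lia)) (hsub 2) (hsub 2)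
    (by rintro (i | i) j <;> exact hyo.2 (by lia))
    (by
      rintro (i | i) j
      · exact hyo.2 (by lia)
      · rw [real_inner_comm]; exact hgy _ _ (by lia))
  have h1 : ℓ h ≤ C₂ + 2 * C₁ := bound h _ _ (hsub 1) (hsub 2) (fun i j => hxy i _)
    (fun i j => hxy i _) (fun i j => hyo.2 (by lia)) fun n => hh (Sum.inl n)
  have h2 : ℓ (h⁻¹ * g) ≤ C₂ + 2 * C₁ := bound (h⁻¹ * g) _ _ (hsub 0) (hsub 1)
    (fun i j => hxy i _) (fun i j => hxy i _) (fun i j => hyo.2 (by lia)) fun n => by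
      have := hh (Sum.inr n)
      show h.symm (g (y (3 * n + 0))) = _
      rw [LinearIsometryEquiv.symm_apply_eq]
      exact this.symm
  have h3 := hmul h (h⁻¹ * g)
  rw [mul_inv_cancel_left] at h3
  linarith

end BoundedLength

section Minkowski

variable {H}

theorem minkB_comm (v w : ℝ × H) : minkB H v w = minkB H w v := by
  simp only [minkB, real_inner_comm, mul_comm]

theorem minkB_add_left (u v w : ℝ × H) : minkB H (u + v) w = minkB H u w + minkB H v w := by
  simp only [minkB, Prod.fst_add, Prod.snd_add, inner_add_left]; ring

theorem minkB_add_right (u v w : ℝ × H) : minkB H u (v + w) = minkB H u v + minkB H u w := by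
  rw [minkB_comm, minkB_add_left, minkB_comm v, minkB_comm w]

theorem minkB_smul_left (c : ℝ) (v w : ℝ × H) : minkB H (c • v) w = c * minkB H v w := by
  simp only [minkB, Prod.smul_fst, Prod.smul_snd, real_inner_smul_left, smul_eq_mul]; ring

theorem minkB_smul_right (c : ℝ) (v w : ℝ × H) : minkB H v (c • w) = c * minkB H v w := by
  rw [minkB_comm, minkB_smul_left, minkB_comm]

theorem minkB_sub_left (u v w : ℝ × H) : minkB H (u - v) w = minkB H u w - minkB H v w := by
  simp only [minkB, Prod.fst_sub, Prod.snd_sub, inner_sub_left]; ring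

theorem minkB_sub_right (u v w : ℝ × H) : minkB H u (v - w) = minkB H u v - minkB H u w := by
  rw [minkB_comm, minkB_sub_left, minkB_comm v, minkB_comm w]

theorem minkB_zero_left (w : ℝ × H) : minkB H 0 w = 0 := by simp [minkB]

theorem continuous_minkB : Continuous fun q : (ℝ × H) × (ℝ × H) => minkB H q.1 q.2 := by
  unfold minkB; fun_prop

theorem Continuous.minkB {X : Type*} [TopologicalSpace X] {f g : X → ℝ × H} (hf : Continuous f)
    (hg : Continuous g) : Continuous fun x => minkB H (f x) (g x) :=
  continuous_minkB.comp (hf.prodMk hg)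

theorem Filter.Tendsto.minkB {X : Type*} {l : Filter X} {f g : X → ℝ × H} {v w : ℝ × H}
    (hf : Filter.Tendsto f l (nhds v)) (hg : Filter.Tendsto g l (nhds w)) :
    Filter.Tendsto (fun x => minkB H (f x) (g x)) l (nhds (minkB H v w)) :=
  (continuous_minkB.tendsto (v, w)).comp (hf.prodMk_nhds hg)

theorem minkB_self (v : ℝ × H) : minkB H v v = v.1 ^ 2 - ‖v.2‖ ^ 2 := by
  rw [minkB, real_inner_self_eq_norm_sq]; ring

/-- The reversed Cauchy–Schwarz inequality. -/
theorem minkB_mul_minkB_le_sq (x : ℝ × H) {y : ℝ × H} (hy : 0 < minkB H y y) :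
    minkB H x x * minkB H y y ≤ minkB H x y ^ 2 := by
  obtain ⟨s, h⟩ := x
  obtain ⟨r, k⟩ := y
  rw [minkB_self] at hy
  rw [minkB_self, minkB_self]
  simp only [minkB] at hy ⊢
  have hr : 0 < r ^ 2 := by nlinarith [sq_nonneg ‖k‖]
  have hw : ‖r • h - s • k‖ ^ 2 = r ^ 2 * ‖h‖ ^ 2 - 2 * (r * s * ⟪h, k⟫) + s ^ 2 * ‖k‖ ^ 2 := by
    rw [norm_sub_sq_real, norm_smul, norm_smul, real_inner_smul_left, real_inner_smul_right,
      mul_pow, mul_pow, Real.norm_eq_abs, Real.norm_eq_abs, sq_abs, sq_abs]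
    ring
  have hwk : ⟪r • h - s • k, k⟫ = r * ⟪h, k⟫ - s * ‖k‖ ^ 2 := by
    rw [inner_sub_left, real_inner_smul_left, real_inner_smul_left, real_inner_self_eq_norm_sq]
  have key : r ^ 2 * ((s * r - ⟪h, k⟫) ^ 2 - (s ^ 2 - ‖h‖ ^ 2) * (r ^ 2 - ‖k‖ ^ 2))
      = ‖r • h - s • k‖ ^ 2 * (r ^ 2 - ‖k‖ ^ 2) + ⟪r • h - s • k, k⟫ ^ 2 := by
    rw [hw, hwk]; ring
  have hpos : 0 ≤ r ^ 2 * ((s * r - ⟪h, k⟫) ^ 2 - (s ^ 2 - ‖h‖ ^ 2) * (r ^ 2 - ‖k‖ ^ 2)) := by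
    rw [key]; positivity
  have := nonneg_of_mul_nonneg_right hpos hr
  linarith

theorem minkB_pos {x y : ℝ × H} (hx : 0 < minkB H x x) (hx1 : 0 < x.1) (hy : 0 ≤ minkB H y y)
    (hy1 : 0 < y.1) : 0 < minkB H x y := by
  rw [minkB_self] at hx hy
  have h1 : ‖x.2‖ < x.1 := lt_of_pow_lt_pow_left₀ 2 hx1.le (by linarith)
  have h2 : ‖y.2‖ ≤ y.1 := le_of_sq_le_sq (by linarith) hy1.le
  have h3 := real_inner_le_norm x.2 y.2
  have h4 : ‖x.2‖ * ‖y.2‖ < x.1 * y.1 := by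
    calc ‖x.2‖ * ‖y.2‖ ≤ ‖x.2‖ * y.1 := by gcongr
      _ < x.1 * y.1 := by gcongr
  rw [minkB]; linarith

theorem one_le_minkB_of_one_le {x y : ℝ × H} (hx : 1 ≤ minkB H x x) (hx1 : 0 < x.1)
    (hy : 1 ≤ minkB H y y) (hy1 : 0 < y.1) : 1 ≤ minkB H x y := by
  have h1 := minkB_pos (by linarith) hx1 (by linarith) hy1
  have h2 := minkB_mul_minkB_le_sq x (by linarith : 0 < minkB H y y)
  nlinarith

theorem one_le_minkB {x y : ℝ × H} (hx : x ∈ Hyp H) (hy : y ∈ Hyp H) : 1 ≤ minkB H x y :=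
  one_le_minkB_of_one_le hx.1.ge hx.2 hy.1.ge hy.2

theorem fst_pos_of_minkB_pos {x y : ℝ × H} (hx : 0 < minkB H x x) (hx1 : 0 < x.1)
    (hy : minkB H y y = 1) (hxy : 0 < minkB H x y) : 0 < y.1 := by
  by_contra! hneg
  have hy0 : y.1 ≠ 0 := by
    intro h0
    rw [minkB_self, h0] at hy
    nlinarith [sq_nonneg ‖y.2‖]
  have h := minkB_pos (x := x) (y := (-1 : ℝ) • y) hx hx1
    (by rw [minkB_smul_left, minkB_smul_right, hy]; norm_num)
    (by simpa using lt_of_le_of_ne hneg hy0)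
  rw [minkB_smul_right] at h
  linarith

theorem minkB_self_le_sq {p : ℝ × H} (hp : p ∈ Hyp H) (v : ℝ × H) :
    minkB H v v ≤ minkB H v p ^ 2 := by
  have := minkB_mul_minkB_le_sq v (y := p) (by rw [hp.1]; norm_num)
  rwa [hp.1, mul_one] at this

variable (H) in
/-- The base point of the hyperboloid. -/
abbrev hypBase : ℝ × H := (1, 0)

theorem hypBase_mem : hypBase H ∈ Hyp H := by simp [Hyp, minkB]

theorem minkB_hypBase (v : ℝ × H) : minkB H v (hypBase H) = v.1 := by simp [minkB]

namespace Oplus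

theorem minkB_map (g : Oplus H) (v w : ℝ × H) : minkB H (g.1 v) (g.1 w) = minkB H v w :=
  g.2.1 v w

theorem mul_apply (g h : Oplus H) (v : ℝ × H) : (g * h).1 v = g.1 (h.1 v) := rfl

theorem one_apply (v : ℝ × H) : (1 : Oplus H).1 v = v := rfl

theorem inv_apply_self (g : Oplus H) (v : ℝ × H) : (g⁻¹).1 (g.1 v) = v :=
  g.1.symm_apply_apply v

theorem apply_inv_self (g : Oplus H) (v : ℝ × H) : g.1 ((g⁻¹).1 v) = v :=
  g.1.apply_symm_apply v

theorem minkB_map_left (g : Oplus H) (v w : ℝ × H) :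
    minkB H (g.1 v) w = minkB H v ((g⁻¹).1 w) := by
  conv_rhs => rw [← minkB_map g, apply_inv_self]

theorem map_mem (g : Oplus H) {v : ℝ × H} (hv : v ∈ Hyp H) : g.1 v ∈ Hyp H :=
  (g.2.2 v).1 hv

end Oplus

/-- The functional `v ↦ B(v, m)`. -/
noncomputable def minkCLM (m : ℝ × H) : (ℝ × H) →L[ℝ] ℝ where
  toFun v := minkB H v m
  map_add' u v := minkB_add_left u v m
  map_smul' c v := minkB_smul_left c v m
  cont := continuous_id.minkB continuous_const

@[simp]
theorem minkCLM_apply (m v : ℝ × H) : minkCLM m v = minkB H v m := rfl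

/-- The linear reflection in the line spanned by `m`. -/
noncomputable def lineReflection (m : ℝ × H) : (ℝ × H) →L[ℝ] (ℝ × H) :=
  (2 / minkB H m m) • (minkCLM m).smulRight m - ContinuousLinearMap.id ℝ _

theorem lineReflection_apply (m v : ℝ × H) :
    lineReflection m v = (2 / minkB H m m) • minkB H v m • m - v := rfl

theorem minkB_lineReflection {m : ℝ × H} (hm : minkB H m m ≠ 0) (v w : ℝ × H) :
    minkB H (lineReflection m v) (lineReflection m w) = minkB H v w := by
  simp only [lineReflection_apply, minkB_sub_left, minkB_sub_right, minkB_smul_left,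
    minkB_smul_right, minkB_comm m]
  field_simp
  ring

theorem lineReflection_lineReflection {m : ℝ × H} (hm : minkB H m m ≠ 0) (v : ℝ × H) :
    lineReflection m (lineReflection m v) = v := by
  simp only [lineReflection_apply, minkB_sub_left, minkB_smul_left, smul_smul]
  have h : 2 / minkB H m m * (2 / minkB H m m * minkB H v m * minkB H m m - minkB H v m)
      = 2 / minkB H m m * minkB H v m := by
    field_simp
    ring
  rw [h, sub_sub_cancel]

theorem lineReflection_mem {x y : ℝ × H} (hx : x ∈ Hyp H) (hy : y ∈ Hyp H) {v : ℝ × H}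
    (hv : v ∈ Hyp H) : lineReflection (x + y) v ∈ Hyp H := by
  have hm : minkB H (x + y) (x + y) = 2 + 2 * minkB H x y := by
    rw [minkB_add_left, minkB_add_right, minkB_add_right, hx.1, hy.1, minkB_comm y x]; ring
  have hm0 : 0 < minkB H (x + y) (x + y) := by
    rw [hm]; linarith [one_le_minkB hx hy]
  have hq : minkB H (lineReflection (x + y) v) (lineReflection (x + y) v) = 1 := by
    rw [minkB_lineReflection hm0.ne', hv.1]
  have hxm : 0 < (x + y).1 := add_pos hx.2 hy.2
  refine ⟨hq, fst_pos_of_minkB_pos hm0 hxm hq ?_⟩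
  have : minkB H (x + y) (lineReflection (x + y) v) = minkB H (x + y) v := by
    rw [lineReflection_apply, minkB_sub_right, minkB_smul_right, minkB_smul_right, minkB_comm v]
    field_simp
    ring
  rw [this]
  exact minkB_pos hm0 hxm (by rw [hv.1]; norm_num) hv.2

/-- The group `O₊(B)` acts transitively on the hyperboloid. -/
theorem exists_oplus_apply_eq {x y : ℝ × H} (hx : x ∈ Hyp H) (hy : y ∈ Hyp H) :
    ∃ g : Oplus H, g.1 x = y := by
  have hm : minkB H (x + y) (x + y) = 2 + 2 * minkB H x y := by
    rw [minkB_add_left, minkB_add_right, minkB_add_right, hx.1, hy.1, minkB_comm y x]; ring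
  have hm0 : minkB H (x + y) (x + y) ≠ 0 := by
    rw [hm]; linarith [one_le_minkB hx hy]
  refine ⟨⟨ContinuousLinearEquiv.equivOfInverse (lineReflection (x + y)) (lineReflection (x + y))
    (lineReflection_lineReflection hm0) (lineReflection_lineReflection hm0),
    minkB_lineReflection hm0, fun v => ⟨lineReflection_mem hx hy, fun h => ?_⟩⟩, ?_⟩
  · rw [← lineReflection_lineReflection hm0 v]
    exact lineReflection_mem hx hy h
  · show lineReflection (x + y) x = y
    rw [lineReflection_apply, hm, minkB_add_right, hx.1, smul_smul]
    have : 2 / (2 + 2 * minkB H x y) * (1 + minkB H x y) = 1 := by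
      have := one_le_minkB hx hy
      field_simp
    rw [this, one_smul, add_sub_cancel_left]

end Minkowski

section FixedPoint

variable {H}

theorem Oplus.exists_norm_sq_le {p : ℝ × H} (hp : p ∈ Hyp H) :
    ∃ C, ∀ v : ℝ × H, ‖v‖ ^ 2 ≤ C * (2 * minkB H v p ^ 2 - minkB H v v) := by
  obtain ⟨g, hg⟩ := exists_oplus_apply_eq hp (hypBase_mem (H := H))
  refine ⟨‖((g⁻¹).1 : (ℝ × H) →L[ℝ] (ℝ × H))‖ ^ 2, fun v => ?_⟩
  have h1 : ‖v‖ ≤ ‖((g⁻¹).1 : (ℝ × H) →L[ℝ] (ℝ × H))‖ * ‖g.1 v‖ := by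
    conv_lhs => rw [← Oplus.inv_apply_self g v]
    exact ((g⁻¹).1 : (ℝ × H) →L[ℝ] (ℝ × H)).le_opNorm _
  have h2 : ‖g.1 v‖ ^ 2 ≤ 2 * minkB H v p ^ 2 - minkB H v v := by
    rw [← Oplus.minkB_map g v p, ← Oplus.minkB_map g v v, hg, minkB_hypBase, minkB_self]
    rcases max_choice ‖(g.1 v).1‖ ‖(g.1 v).2‖ with h | h
    · rw [Prod.norm_def, h, Real.norm_eq_abs, sq_abs]
      nlinarith [sq_nonneg ‖(g.1 v).2‖]
    · rw [Prod.norm_def, h]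
      nlinarith [sq_nonneg (g.1 v).1]
  calc ‖v‖ ^ 2 ≤ (‖((g⁻¹).1 : (ℝ × H) →L[ℝ] (ℝ × H))‖ * ‖g.1 v‖) ^ 2 := by gcongr
    _ = ‖((g⁻¹).1 : (ℝ × H) →L[ℝ] (ℝ × H))‖ ^ 2 * ‖g.1 v‖ ^ 2 := by ring
    _ ≤ _ := by gcongr

theorem norm_le_of_abs_minkB_le {x u : ℝ × H} {C ε : ℝ} (hx : 1 ≤ minkB H x x) (hx1 : 0 < x.1)
    (hC : ‖x‖ ≤ C) (hε : 0 ≤ ε) (hε1 : ε ≤ 1) (hq : -(4 * ε ^ 2) ≤ minkB H u u)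
    (hB : |minkB H u x| ≤ 2 * ε ^ 2) : ‖u‖ ≤ (4 * C + 4 * C ^ 2 + 2) * ε := by
  obtain ⟨s, h⟩ := x
  obtain ⟨a, k⟩ := u
  rw [minkB_self] at hx hq
  simp only [minkB] at hx hx1 hq hB
  have hC1 : s ≤ C := (le_abs_self s).trans ((norm_fst_le (s, h)).trans hC)
  have hC2 : ‖h‖ ≤ C := (norm_snd_le (s, h)).trans hC
  have hC0 : 0 ≤ C := (norm_nonneg h).trans hC2
  have hk : ‖k‖ ≤ |a| + 2 * ε := by
    refine le_of_sq_le_sq ?_ (by positivity)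
    nlinarith [sq_abs a, abs_nonneg a]
  have hinner : |⟪k, h⟫| ≤ (|a| + 2 * ε) * ‖h‖ :=
    (abs_real_inner_le_norm k h).trans (by gcongr)
  have has : |a| * s ≤ 2 * ε ^ 2 + (|a| + 2 * ε) * ‖h‖ := by
    calc |a| * s = |(a * s - ⟪k, h⟫) + ⟪k, h⟫| := by
          rw [sub_add_cancel, abs_mul, abs_of_pos hx1]
      _ ≤ _ := (abs_add_le _ _).trans (add_le_add hB hinner)
  have hlow : |a| ≤ |a| * (s - ‖h‖) * (2 * C) := by
    have h1 : 0 < s - ‖h‖ := by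
      by_contra! hneg
      nlinarith [norm_nonneg h]
    have h2 : 1 ≤ (s - ‖h‖) * (2 * C) := by nlinarith
    nlinarith [mul_le_mul_of_nonneg_left h2 (abs_nonneg a)]
  have ha : |a| ≤ (4 * C + 4 * C ^ 2) * ε := by
    have h1 : |a| * (s - ‖h‖) ≤ 2 * ε + 2 * ε * C := by nlinarith
    nlinarith
  rw [Prod.norm_def]
  refine max_le ?_ ?_
  · rw [Real.norm_eq_abs]; linarith
  · simp only; linarith

/-- A group of isometries with a bounded orbit fixes a point of the hyperboloid. -/
theorem exists_fixed_point_of_bounded [CompleteSpace H] (Q : Subgroup (Oplus H)) {C : ℝ}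
    (hC : ∀ g ∈ Q, ‖g.1 (hypBase H)‖ ≤ C) : ∃ p ∈ Hyp H, ∀ g ∈ Q, g.1 p = p := by
  set K : Set (ℝ × H) := convexHull ℝ ((fun g : Oplus H => g.1 (hypBase H)) '' Q) with hK
  have hbase : hypBase H ∈ K := subset_convexHull ℝ _ ⟨1, Q.one_mem, rfl⟩
  have hKtime : K ⊆ {x | 1 ≤ minkB H x x ∧ 0 < x.1} := by
    refine convexHull_min ?_ ?_
    · rintro _ ⟨g, -, rfl⟩
      exact ⟨(Oplus.map_mem g hypBase_mem).1.ge, (Oplus.map_mem g hypBase_mem).2⟩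
    · rintro x ⟨hx, hx1⟩ y ⟨hy, hy1⟩ a b ha hb hab
      have hxy := one_le_minkB_of_one_le hx hx1 hy hy1
      constructor
      · simp only [minkB_add_left, minkB_add_right, minkB_smul_left, minkB_smul_right,
          minkB_comm y x]
        have h1 : (1 : ℝ) = a * a + a * b + (b * a + b * b) := by
          rw [← mul_add, ← mul_add, hab]; linarith
        rw [h1]
        have e1 := mul_le_mul_of_nonneg_left hx (mul_nonneg ha ha)
        have e2 := mul_le_mul_of_nonneg_left hy (mul_nonneg hb hb)
        have e3 := mul_le_mul_of_nonneg_left hxy (mul_nonneg ha hb)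
        nlinarith
      · show 0 < a * x.1 + b * y.1
        rcases ha.eq_or_lt with rfl | ha
        · rw [zero_add] at hab
          simpa [hab] using hy1
        · have := mul_pos ha hx1
          have := mul_nonneg hb hy1.le
          linarith
  have hKnorm : ∀ x ∈ K, ‖x‖ ≤ C := by
    have : K ⊆ Metric.closedBall 0 C := by
      refine convexHull_min ?_ (convex_closedBall _ _)
      rintro _ ⟨g, hg, rfl⟩
      simpa using hC g hg
    intro x hx
    simpa using this hx
  have hKinv : ∀ g ∈ Q, ∀ x ∈ K, g.1 x ∈ K := by
    intro g hg
    have hconv : Convex ℝ ((g.1 : (ℝ × H) →ₗ[ℝ] (ℝ × H)) ⁻¹' K) :=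
      (convex_convexHull ℝ _).linear_preimage _
    refine convexHull_min ?_ hconv
    rintro _ ⟨k, hk, rfl⟩
    exact subset_convexHull ℝ _ ⟨g * k, Q.mul_mem hg hk, rfl⟩
  have hbdd : BddAbove ((fun x => minkB H x x) '' K) := by
    refine ⟨C ^ 2, ?_⟩
    rintro _ ⟨x, hx, rfl⟩
    have h1 : |x.1| ≤ C := (norm_fst_le x).trans (hKnorm x hx)
    simp only [minkB_self]
    nlinarith [sq_nonneg ‖x.2‖, abs_nonneg x.1, sq_abs x.1]
  set m := sSup ((fun x => minkB H x x) '' K) with hm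
  have hle : ∀ x ∈ K, minkB H x x ≤ m := fun x hx => le_csSup hbdd ⟨x, hx, rfl⟩
  set D := 4 * C + 4 * C ^ 2 + 2 with hD
  have hclose : ∀ ε, 0 ≤ ε → ε ≤ 1 → ∀ x ∈ K, ∀ y ∈ K, m - ε ^ 2 ≤ minkB H x x →
      m - ε ^ 2 ≤ minkB H y y → ‖x - y‖ ≤ D * ε := by
    intro ε hε hε1 x hx y hy hqx hqy
    have hmid := hle _ (convex_convexHull ℝ _ hx hy (by norm_num : (0 : ℝ) ≤ 1 / 2)
      (by norm_num : (0 : ℝ) ≤ 1 / 2) (by norm_num))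
    simp only [minkB_add_left, minkB_add_right, minkB_smul_left, minkB_smul_right,
      minkB_comm y x] at hmid
    have hx2 := hKtime hx
    have hy2 := hKtime hy
    have hxm := hle x hx
    have hym := hle y hy
    have hone := one_le_minkB_of_one_le hx2.1 hx2.2 hy2.1 hy2.2
    have hcs := minkB_mul_minkB_le_sq x (by linarith [hy2.1] : 0 < minkB H y y)
    have hlow : m - ε ^ 2 ≤ minkB H x y := by
      by_contra! hlt
      have h1 : minkB H x y < minkB H x x := by linarith
      have h2 : minkB H x y < minkB H y y := by linarith
      nlinarith
    refine norm_le_of_abs_minkB_le hx2.1 hx2.2 (hKnorm x hx) hε hε1 ?_ ?_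
    · simp only [minkB_sub_left, minkB_sub_right, minkB_comm y x]
      linarith
    · rw [minkB_sub_left, minkB_comm y x, abs_le]
      constructor <;> nlinarith
  have hseq : ∀ n : ℕ, ∃ x ∈ K, m - (1 / ((n : ℝ) + 1)) ^ 2 ≤ minkB H x x := by
    intro n
    have hlt : m - (1 / ((n : ℝ) + 1)) ^ 2 < m := sub_lt_self _ (by positivity)
    obtain ⟨_, ⟨x, hx, rfl⟩, h⟩ := exists_lt_of_lt_csSup (Set.Nonempty.image _ ⟨_, hbase⟩) hlt
    exact ⟨x, hx, h.le⟩
  choose x hxK hxq using hseq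
  have hpos : ∀ n : ℕ, 0 ≤ 1 / ((n : ℝ) + 1) := fun n => by positivity
  have hone : ∀ n : ℕ, 1 / ((n : ℝ) + 1) ≤ 1 := fun n => by
    rw [div_le_one (by positivity)]; linarith [n.cast_nonneg (α := ℝ)]
  have hlim : Filter.Tendsto (fun n : ℕ => D * (1 / ((n : ℝ) + 1))) Filter.atTop (nhds 0) := by
    simpa using tendsto_one_div_add_atTop_nhds_zero_nat.const_mul D
  have hmono : ∀ {N n : ℕ}, N ≤ n → m - (1 / ((N : ℝ) + 1)) ^ 2 ≤ minkB H (x n) (x n) := by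
    intro N n hNn
    refine le_trans ?_ (hxq n)
    have : 1 / ((n : ℝ) + 1) ≤ 1 / ((N : ℝ) + 1) := by gcongr
    have := hpos n
    gcongr
  have hcauchy : CauchySeq x := by
    refine cauchySeq_of_le_tendsto_0 _ (fun n k N hn hk => ?_) hlim
    rw [dist_eq_norm]
    exact hclose _ (hpos N) (hone N) _ (hxK n) _ (hxK k) (hmono hn) (hmono hk)
  obtain ⟨y, hy⟩ := cauchySeq_tendsto_of_complete hcauchy
  have hyfix : ∀ g ∈ Q, g.1 y = y := by
    intro g hg
    have h1 : Filter.Tendsto (fun n => x n - g.1 (x n)) Filter.atTop (nhds (y - g.1 y)) :=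
      hy.sub ((g.1.continuous.tendsto y).comp hy)
    have h2 : Filter.Tendsto (fun n => x n - g.1 (x n)) Filter.atTop (nhds 0) := by
      refine squeeze_zero_norm (fun n => ?_) hlim
      exact hclose _ (hpos n) (hone n) _ (hxK n) _ (hKinv g hg _ (hxK n)) (hxq n)
        (by rw [Oplus.minkB_map]; exact hxq n)
    exact (sub_eq_zero.1 (tendsto_nhds_unique h1 h2)).symm
  have hyq : 1 ≤ minkB H y y :=
    ge_of_tendsto' (hy.minkB hy) fun n => (hKtime (hxK n)).1
  have hy1 : 0 ≤ y.1 :=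
    ge_of_tendsto' ((continuous_fst.tendsto y).comp hy) fun n => (hKtime (hxK n)).2.le
  have hy0 : y.1 ≠ 0 := by
    intro h0
    rw [minkB_self, h0] at hyq
    nlinarith [sq_nonneg ‖y.2‖]
  have hsq : 0 < √(minkB H y y) := Real.sqrt_pos.2 (by linarith)
  refine ⟨(√(minkB H y y))⁻¹ • y, ⟨?_, ?_⟩, fun g hg => ?_⟩
  · rw [minkB_smul_left, minkB_smul_right, ← mul_assoc, ← mul_inv, Real.mul_self_sqrt (by linarith)]
    exact inv_mul_cancel₀ (by linarith)
  · exact mul_pos (inv_pos.2 hsq) (lt_of_le_of_ne hy1 hy0.symm)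
  · rw [map_smul, hyfix g hg]

end FixedPoint

section Stabilizer

variable {H}

variable (H) in
/-- Orthogonal transformations of `H`, acting on the second factor of `ℝ × H`. -/
noncomputable def Oplus.ofOrthogonal : (H ≃ₗᵢ[ℝ] H) →* Oplus H where
  toFun k := ⟨(ContinuousLinearEquiv.refl ℝ ℝ).prodCongr k.toContinuousLinearEquiv, by
    have h : ∀ v w : ℝ × H, minkB H (((ContinuousLinearEquiv.refl ℝ ℝ).prodCongr
        k.toContinuousLinearEquiv) v) (((ContinuousLinearEquiv.refl ℝ ℝ).prodCongr
        k.toContinuousLinearEquiv) w) = minkB H v w := fun v w => by simp [minkB]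
    exact ⟨h, fun v => by simp only [Hyp, Set.mem_ofPred_eq, h]; simp⟩⟩
  map_one' := rfl
  map_mul' _ _ := rfl

namespace Oplus

theorem ofOrthogonal_apply (k : H ≃ₗᵢ[ℝ] H) (v : ℝ × H) :
    (ofOrthogonal H k).1 v = (v.1, k v.2) := rfl

theorem inv_apply_eq {g : Oplus H} {v w : ℝ × H} (h : g.1 v = w) : (g⁻¹).1 w = v := by
  rw [← h, inv_apply_self]

theorem apply_zero_snd {g : Oplus H} (hg : g.1 (hypBase H) = hypBase H) (h : H) :
    g.1 (0, h) = (0, (g.1 (0, h)).2) := by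
  refine Prod.ext ?_ rfl
  show (g.1 (0, h)).1 = 0
  rw [← minkB_hypBase, minkB_map_left, inv_apply_eq hg, minkB_hypBase]

/-- The stabilizer of the base point consists of orthogonal transformations. -/
theorem exists_ofOrthogonal_eq {g : Oplus H} (hg : g.1 (hypBase H) = hypBase H) :
    ∃ k, ofOrthogonal H k = g := by
  have hg' := inv_apply_eq hg
  let e : H ≃ₗ[ℝ] H :=
    { toFun := fun h => (g.1 (0, h)).2
      map_add' := fun h k => by
        rw [← Prod.snd_add, ← map_add, Prod.mk_add_mk, add_zero]
      map_smul' := fun c h => by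
        rw [RingHom.id_apply, ← Prod.smul_snd, ← map_smul, Prod.smul_mk, smul_zero]
      invFun := fun h => ((g⁻¹).1 (0, h)).2
      left_inv := fun h => by
        simp only
        rw [← apply_zero_snd hg, inv_apply_self]
      right_inv := fun h => by
        simp only
        rw [← apply_zero_snd hg', apply_inv_self] }
  have he : ∀ h, ‖e h‖ = ‖h‖ := fun h => by
    have h1 := minkB_map g (0, h) (0, h)
    rw [apply_zero_snd hg, minkB_self, minkB_self] at h1
    have h2 : ‖(g.1 (0, h)).2‖ ^ 2 = ‖h‖ ^ 2 := by simp only at h1; linarith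
    exact (sq_eq_sq₀ (norm_nonneg _) (norm_nonneg _)).1 h2
  refine ⟨⟨e, he⟩, Subtype.ext (ContinuousLinearEquiv.ext (funext fun v => ?_))⟩
  obtain ⟨s, h⟩ := v
  have hv : ((s, h) : ℝ × H) = s • hypBase H + (0, h) := by simp
  show (s, (g.1 (0, h)).2) = g.1 (s, h)
  rw [hv, map_add, map_smul, hg, apply_zero_snd hg]
  simp

/-- The stabilizer of the base point is transitive on spheres around it. -/
theorem exists_apply_eq_of_fst_eq {x y : ℝ × H} (hx : x ∈ Hyp H) (hy : y ∈ Hyp H)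
    (h : x.1 = y.1) : ∃ k : Oplus H, k.1 (hypBase H) = hypBase H ∧ k.1 x = y := by
  have hnorm : ‖x.2‖ = ‖y.2‖ := by
    have h1 := hx.1
    have h2 := hy.1
    rw [minkB_self] at h1 h2
    refine (sq_eq_sq₀ (norm_nonneg _) (norm_nonneg _)).1 ?_
    rw [h] at h1
    linarith
  refine ⟨ofOrthogonal H (Submodule.reflection (ℝ ∙ (x.2 - y.2))ᗮ), ?_, ?_⟩
  · simp [ofOrthogonal_apply]
  · rw [ofOrthogonal_apply, Submodule.reflection_sub hnorm, h]

theorem norm_coe_pos (g : Oplus H) : 0 < ‖(g.1 : (ℝ × H) →L[ℝ] (ℝ × H))‖ := by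
  have h1 : 0 < ‖g.1 (hypBase H)‖ := by
    rw [norm_pos_iff]
    intro h
    have h2 := (map_mem g hypBase_mem).2
    rw [h] at h2
    exact lt_irrefl _ h2
  have h2 : ‖g.1 (hypBase H)‖ ≤ _ := (g.1 : (ℝ × H) →L[ℝ] (ℝ × H)).le_opNorm (hypBase H)
  exact pos_of_mul_pos_left (h1.trans_le h2) (norm_nonneg _)

theorem norm_coe_mul_le (g h : Oplus H) : ‖((g * h).1 : (ℝ × H) →L[ℝ] (ℝ × H))‖ ≤
    ‖(g.1 : (ℝ × H) →L[ℝ] (ℝ × H))‖ * ‖(h.1 : (ℝ × H) →L[ℝ] (ℝ × H))‖ := by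
  refine ContinuousLinearMap.opNorm_le_bound _ (by positivity) fun v => ?_
  have h1 : ‖g.1 (h.1 v)‖ ≤ _ := (g.1 : (ℝ × H) →L[ℝ] (ℝ × H)).le_opNorm (h.1 v)
  have h2 : ‖h.1 v‖ ≤ _ := (h.1 : (ℝ × H) →L[ℝ] (ℝ × H)).le_opNorm v
  rw [mul_assoc]
  exact h1.trans (mul_le_mul_of_nonneg_left h2 (norm_nonneg _))

theorem log_norm_mul_le (g h : Oplus H) :
    Real.log ‖((g * h).1 : (ℝ × H) →L[ℝ] (ℝ × H))‖ ≤
      Real.log ‖(g.1 : (ℝ × H) →L[ℝ] (ℝ × H))‖ + Real.log ‖(h.1 : (ℝ × H) →L[ℝ] (ℝ × H))‖ := by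
  rw [← Real.log_mul (norm_coe_pos g).ne' (norm_coe_pos h).ne']
  exact Real.log_le_log (norm_coe_pos _) (norm_coe_mul_le g h)

/-- Any homomorphism from the orthogonal group to `O₊(B)` fixes a point of the hyperboloid. -/
theorem exists_fixed_point_orthogonal [CompleteSpace H] [TopologicalSpace.SeparableSpace H]
    (hinf : ¬ FiniteDimensional ℝ H) (π : (H ≃ₗᵢ[ℝ] H) →* Oplus H) :
    ∃ p ∈ Hyp H, ∀ k, (π k).1 p = p := by
  obtain ⟨C, hC⟩ := exists_bound_length hinf
    (fun k => max (Real.log ‖((π k).1 : (ℝ × H) →L[ℝ] (ℝ × H))‖)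
      (Real.log ‖((π k)⁻¹.1 : (ℝ × H) →L[ℝ] (ℝ × H))‖))
    (fun g h => by
      rw [map_mul, mul_inv_rev]
      refine max_le ((log_norm_mul_le _ _).trans (add_le_add (le_max_left _ _) (le_max_left _ _)))
        ((log_norm_mul_le _ _).trans ?_)
      rw [add_comm]
      exact add_le_add (le_max_right _ _) (le_max_right _ _))
    (fun g => by rw [map_inv, inv_inv, max_comm])
  obtain ⟨p, hp, hfix⟩ := exists_fixed_point_of_bounded π.range (C := Real.exp C * ‖hypBase H‖)
    (by
      rintro _ ⟨k, rfl⟩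
      refine (((π k).1 : (ℝ × H) →L[ℝ] (ℝ × H)).le_opNorm _).trans ?_
      gcongr
      rw [← Real.log_le_iff_le_exp (norm_coe_pos _)]
      exact (le_max_left _ _).trans (hC k))
  exact ⟨p, hp, fun k => hfix _ ⟨k, rfl⟩⟩

end Oplus

end Stabilizer

section Representation

variable {H}

namespace Oplus

/-- The hyperbolic cosine of the distance by which `g` displaces the base point. -/
noncomputable def coshDisp (g : Oplus H) : ℝ := (g.1 (hypBase H)).1

theorem coshDisp_eq (g : Oplus H) : coshDisp g = minkB H (g.1 (hypBase H)) (hypBase H) :=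
  (minkB_hypBase _).symm

theorem one_le_coshDisp (g : Oplus H) : 1 ≤ coshDisp g := by
  rw [coshDisp_eq]
  exact one_le_minkB (map_mem g hypBase_mem) hypBase_mem

theorem coshDisp_inv_mul (g h : Oplus H) :
    coshDisp (h⁻¹ * g) = minkB H (g.1 (hypBase H)) (h.1 (hypBase H)) := by
  rw [coshDisp_eq, mul_apply, minkB_map_left, inv_inv]

theorem coshDisp_one : coshDisp (1 : Oplus H) = 1 := rfl

theorem coshDisp_mul_of_fixed {k : Oplus H} (hk : k.1 (hypBase H) = hypBase H) (g : Oplus H) :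
    coshDisp (k * g) = coshDisp g := by
  rw [coshDisp_eq, mul_apply, minkB_map_left, inv_apply_eq hk, ← coshDisp_eq]

/-- The point at hyperbolic distance `arcosh a` from the base point in the direction `e`. -/
noncomputable def polarPoint (a : ℝ) (e : H) : ℝ × H := (a, √(a ^ 2 - 1) • e)

theorem exists_apply_eq_polarPoint {a : ℝ} (ha : 1 ≤ a) {e : H} (he : ‖e‖ = 1) :
    ∃ g : Oplus H, g.1 (hypBase H) = polarPoint a e := by
  refine exists_oplus_apply_eq hypBase_mem ⟨?_, by simp only [polarPoint]; linarith⟩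
  rw [minkB_self, polarPoint, norm_smul, he, mul_one, Real.norm_eq_abs, sq_abs,
    Real.sq_sqrt (by nlinarith)]
  ring

variable (H) in
/-- An element displacing the base point by `arcosh a`. -/
noncomputable def ofCosh (a : ℝ) : Oplus H := Function.invFun coshDisp a

theorem coshDisp_ofCosh [Nontrivial H] {a : ℝ} (ha : 1 ≤ a) : coshDisp (ofCosh H a) = a := by
  obtain ⟨e, he⟩ := exists_norm_eq H zero_le_one
  obtain ⟨g, hg⟩ := exists_apply_eq_polarPoint ha he
  exact Function.invFun_eq (f := coshDisp) ⟨g, by rw [coshDisp, hg]; rfl⟩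

/-- There are no proper nonzero closed invariant subspaces. -/
def IsIrreducible (ρ : Oplus H →* Oplus H) : Prop :=
  ∀ N : Submodule ℝ (ℝ × H), IsClosed (N : Set (ℝ × H)) →
    (∀ g : Oplus H, ∀ v ∈ N, (ρ g).1 v ∈ N) → N = ⊥ ∨ N = ⊤

/-- Vectors fixed by the image of the stabilizer of the base point. -/
def IsSpherical (ρ : Oplus H →* Oplus H) (z : ℝ × H) : Prop :=
  ∀ k : Oplus H, k.1 (hypBase H) = hypBase H → (ρ k).1 z = z

variable {ρ : Oplus H →* Oplus H}

/-- The spherical matrix coefficient as a function of the cosh of the displacement. -/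
noncomputable def coeff (ρ : Oplus H →* Oplus H) (z z' : ℝ × H) (a : ℝ) : ℝ :=
  minkB H ((ρ (ofCosh H a)).1 z) z'

theorem IsSpherical.minkB_eq_of_coshDisp_eq {z z' : ℝ × H} (hz : IsSpherical ρ z)
    (hz' : IsSpherical ρ z') {g g' : Oplus H} (h : coshDisp g = coshDisp g') :
    minkB H ((ρ g).1 z) z' = minkB H ((ρ g').1 z) z' := by
  obtain ⟨k, hk, hkg⟩ := exists_apply_eq_of_fst_eq (map_mem g hypBase_mem)
    (map_mem g' hypBase_mem) h
  have h1 : (ρ (g'⁻¹ * (k * g))).1 z = z := hz _ (by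
    rw [mul_apply, mul_apply, hkg, inv_apply_self])
  have h2 : (ρ k).1 ((ρ g).1 z) = (ρ g').1 z := by
    conv_rhs => rw [← h1, map_mul, mul_apply, map_inv, apply_inv_self, map_mul, mul_apply]
  rw [← h2, minkB_map_left (ρ k), inv_apply_eq (hz' k hk)]

theorem IsSpherical.minkB_eq_coeff [Nontrivial H] {z z' : ℝ × H} (hz : IsSpherical ρ z)
    (hz' : IsSpherical ρ z') (g : Oplus H) :
    minkB H ((ρ g).1 z) z' = coeff ρ z z' (coshDisp g) :=
  hz.minkB_eq_of_coshDisp_eq hz' (coshDisp_ofCosh (one_le_coshDisp g)).symm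

theorem IsSpherical.minkB_map_map_eq_coeff [Nontrivial H] {z z' : ℝ × H} (hz : IsSpherical ρ z)
    (hz' : IsSpherical ρ z') (g h : Oplus H) : minkB H ((ρ g).1 z) ((ρ h).1 z') =
      coeff ρ z z' (minkB H (g.1 (hypBase H)) (h.1 (hypBase H))) := by
  rw [← coshDisp_inv_mul, ← hz.minkB_eq_coeff hz', map_mul, mul_apply, map_inv,
    minkB_map_left (ρ h)⁻¹, inv_inv]

theorem one_le_coeff {p : ℝ × H} (hp : p ∈ Hyp H) (a : ℝ) : 1 ≤ coeff ρ p p a :=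
  one_le_minkB (map_mem _ hp) hp

theorem isClosed_isSpherical : IsClosed {z | IsSpherical ρ z} := by
  simp only [IsSpherical, Set.ofPred_forall]
  exact isClosed_iInter fun k => isClosed_iInter fun _ =>
    isClosed_eq (ρ k).1.continuous continuous_id

theorem IsSpherical.smul {z : ℝ × H} (hz : IsSpherical ρ z) (c : ℝ) : IsSpherical ρ (c • z) :=
  fun k hk => by rw [map_smul, hz k hk]

theorem eq_zero_of_forall_minkB_eq_zero (hirr : IsIrreducible ρ) {p : ℝ × H} (hp : p ∈ Hyp H)
    {v : ℝ × H} (hv : ∀ g, minkB H v ((ρ g).1 p) = 0) : v = 0 := by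
  let N : Submodule ℝ (ℝ × H) :=
    { carrier := {v | ∀ g, minkB H v ((ρ g).1 p) = 0}
      add_mem' := fun {u v} hu hv g => by rw [minkB_add_left, hu g, hv g, add_zero]
      zero_mem' := fun g => minkB_zero_left _
      smul_mem' := fun c v hv g => by rw [minkB_smul_left, hv g, mul_zero] }
  have hN : IsClosed (N : Set (ℝ × H)) := by
    show IsClosed {v | ∀ g, minkB H v ((ρ g).1 p) = 0}
    simp only [Set.ofPred_forall]
    exact isClosed_iInter fun g => isClosed_eq (continuous_id.minkB continuous_const)
      continuous_const
  rcases hirr N hN (fun g v hv h => by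
    rw [minkB_map_left, ← mul_apply, ← map_inv, ← map_mul]; exact hv _) with h | h
  · have : v ∈ N := hv
    rwa [h, Submodule.mem_bot] at this
  · have h1 : p ∈ N := by rw [h]; trivial
    have h2 : minkB H p ((ρ 1).1 p) = 0 := h1 1
    rw [map_one, one_apply, hp.1] at h2
    norm_num at h2

end Oplus

end Representation

section WeakLimit

variable {H}

theorem norm_minkCLM_le (m : ℝ × H) : ‖minkCLM m‖ ≤ 2 * ‖m‖ := by
  refine ContinuousLinearMap.opNorm_le_bound _ (by positivity) fun v => ?_
  have h1 : ‖v.1 * m.1‖ ≤ ‖v‖ * ‖m‖ := by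
    rw [norm_mul]
    exact mul_le_mul (norm_fst_le v) (norm_fst_le m) (norm_nonneg _) (norm_nonneg _)
  have h2 : ‖⟪v.2, m.2⟫‖ ≤ ‖v‖ * ‖m‖ := (norm_inner_le_norm v.2 m.2).trans
    (mul_le_mul (norm_snd_le v) (norm_snd_le m) (norm_nonneg _) (norm_nonneg _))
  have h3 := norm_sub_le (v.1 * m.1) ⟪v.2, m.2⟫
  rw [minkCLM_apply, minkB]
  linarith

/-- The Riesz representation theorem for the Minkowski form. -/
theorem exists_minkB_eq [CompleteSpace H] (φ : (ℝ × H) →L[ℝ] ℝ) :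
    ∃ w, ∀ v, φ v = minkB H w v := by
  refine ⟨(φ (1, 0), -(InnerProductSpace.toDual ℝ H).symm
    (φ.comp (ContinuousLinearMap.inr ℝ ℝ H))), fun v => ?_⟩
  obtain ⟨s, h⟩ := v
  have hv : ((s, h) : ℝ × H) = s • (1, 0) + (0, h) := by simp
  rw [minkB, inner_neg_left, InnerProductSpace.toDual_symm_apply]
  conv_lhs => rw [hv, map_add, map_smul]
  simp [mul_comm]

theorem exists_tendsto_minkB [CompleteSpace H] {α : Type*} (l : Ultrafilter α) {u : α → ℝ × H}
    {R : ℝ} (hu : ∀ s, ‖u s‖ ≤ R) :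
    ∃ w, ∀ v, Filter.Tendsto (fun s => minkB H (u s) v) l (nhds (minkB H w v)) := by
  let f : α → WeakDual ℝ (ℝ × H) := fun s => StrongDual.toWeakDual (minkCLM (u s))
  have hK := WeakDual.isCompact_closedBall (𝕜 := ℝ) (0 : StrongDual ℝ (ℝ × H)) (2 * R)
  obtain ⟨φ, -, hφ⟩ := hK.ultrafilter_le_nhds' (l.map f)
    (Filter.mem_map.2 (Filter.univ_mem' fun s => by
      exact mem_closedBall_zero_iff.2 ((norm_minkCLM_le _).trans (by linarith [hu s]))))
  obtain ⟨w, hw⟩ := exists_minkB_eq (WeakDual.toStrongDual φ)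
  refine ⟨w, fun v => ?_⟩
  have h1 : Filter.Tendsto f l (nhds φ) := hφ
  have h2 := ((WeakDual.eval_continuous v).tendsto φ).comp h1
  rw [← hw v]
  refine h2.congr fun s => ?_
  exact minkB_comm _ _

namespace Oplus

variable {ρ : Oplus H →* Oplus H}

/-- Averaging `p` over a sphere of radius `arcosh a` yields a spherical vector. -/
theorem exists_isSpherical_minkB_eq_coeff [CompleteSpace H] (hinf : ¬ FiniteDimensional ℝ H)
    (hirr : IsIrreducible ρ) {p : ℝ × H} (hp : p ∈ Hyp H) (hps : IsSpherical ρ p) {a : ℝ}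
    (ha : 1 ≤ a) : ∃ w, IsSpherical ρ w ∧ ∀ z, IsSpherical ρ z → ∀ g,
      minkB H w ((ρ g).1 z) = coeff ρ p z (a * coshDisp g) := by
  have : Nontrivial H := by
    by_contra h
    rw [not_nontrivial_iff_subsingleton] at h
    exact hinf inferInstance
  have htop : ¬ FiniteDimensional ℝ (⊤ : Submodule ℝ H) := fun h =>
    hinf (Module.Finite.equiv (Submodule.topEquiv (R := ℝ) (M := H)))
  have hex : ∀ S : Finset H, ∃ g : Oplus H, ∃ e : H, (∀ s ∈ S, ⟪s, e⟫ = 0) ∧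
      g.1 (hypBase H) = polarPoint a e := fun S => by
    obtain ⟨e, -, he, hS⟩ := exists_unit_mem_orthogonal_finset ⊤ htop S
    obtain ⟨g, hg⟩ := exists_apply_eq_polarPoint ha he
    exact ⟨g, e, hS, hg⟩
  choose g e he hg using hex
  have hdisp : ∀ S, coshDisp (g S) = a := fun S => by rw [coshDisp, hg]; rfl
  obtain ⟨C, hC⟩ := exists_norm_sq_le hp
  have hbound : ∀ S, ‖(ρ (g S)).1 p‖ ≤ √(C * (2 * coeff ρ p p a ^ 2 - 1)) := fun S => by
    refine Real.le_sqrt_of_sq_le ((hC _).trans_eq ?_)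
    rw [minkB_map, hp.1, hps.minkB_eq_coeff hps, hdisp]
  obtain ⟨w, hw⟩ := exists_tendsto_minkB (Ultrafilter.of Filter.atTop) hbound
  have hval : ∀ z, IsSpherical ρ z → ∀ h,
      minkB H w ((ρ h).1 z) = coeff ρ p z (a * coshDisp h) := by
    intro z hz h
    refine tendsto_nhds_unique (hw _) ?_
    refine Filter.Tendsto.congr' ?_ tendsto_const_nhds
    refine Ultrafilter.of_le Filter.atTop ?_
    filter_upwards [Filter.eventually_ge_atTop {(h.1 (hypBase H)).2}] with S hS
    rw [hps.minkB_map_map_eq_coeff hz, hg, minkB, polarPoint, real_inner_smul_left,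
      real_inner_comm, he S _ (hS (Finset.mem_singleton_self _)), mul_zero, sub_zero]
    rfl
  refine ⟨w, fun k hk => ?_, hval⟩
  rw [← sub_eq_zero]
  refine eq_zero_of_forall_minkB_eq_zero hirr hp fun h => ?_
  rw [minkB_sub_left, minkB_map_left, ← map_inv, ← mul_apply, ← map_mul, hval p hps, hval p hps,
    coshDisp_mul_of_fixed (inv_apply_eq hk), sub_self]

end Oplus

end WeakLimit

section Multiplicativity

variable {H}

/-- The Gram matrix of a normalized log-concave sequence decreases in each index. -/
theorem antitone_add_div_mul {F : ℕ → ℝ} (hpos : ∀ n, 0 < F n)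
    (hF : ∀ n, F n * F (n + 2) ≤ F (n + 1) ^ 2) (m : ℕ) :
    Antitone fun n => F (n + m) / (F n * F m) := by
  have hr : Antitone fun n => F (n + 1) / F n := antitone_nat_of_succ_le fun n => by
    rw [div_le_div_iff₀ (hpos _) (hpos _)]
    linarith [hF n]
  refine antitone_nat_of_succ_le fun n => ?_
  have h := hr (Nat.le_add_right n m)
  simp only at h
  rw [div_le_div_iff₀ (hpos _) (hpos _)] at h
  rw [div_le_div_iff₀ (mul_pos (hpos _) (hpos _)) (mul_pos (hpos _) (hpos _)), add_right_comm]
  nlinarith [hpos m]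

namespace Oplus

variable {ρ : Oplus H →* Oplus H}

/-- Projecting an iterated spherical mean to the hyperplane `B(·, p) = 1` converges to an
eigenvector of the spherical mean. -/
theorem exists_isSpherical_eigenvector [CompleteSpace H] {p : ℝ × H} (hp : p ∈ Hyp H)
    [Nontrivial H] (hps : IsSpherical ρ p) {P : ℝ → ℝ × H}
    (hPs : ∀ a, 1 ≤ a → IsSpherical ρ (P a))
    (hP : ∀ a, 1 ≤ a → ∀ z, IsSpherical ρ z → ∀ g,
      minkB H (P a) ((ρ g).1 z) = coeff ρ p z (a * coshDisp g)) {a : ℝ} (ha : 1 ≤ a) :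
    ∃ z, IsSpherical ρ z ∧ minkB H z p = 1 ∧ ∃ l : ℝ, ∀ b, 1 ≤ b →
      minkB H z (P (a * b)) = l * minkB H z (P b) := by
  have hPb : ∀ c b, 1 ≤ c → 1 ≤ b → minkB H (P c) (P b) = coeff ρ p p (c * b) := by
    intro c b hc hb
    have h1 := hP c hc (P b) (hPs b hb) 1
    rw [map_one, one_apply, coshDisp_one, mul_one] at h1
    rw [h1, coeff, minkB_comm, hP b hb p hps, coshDisp_ofCosh hc, mul_comm]
  have hPp : ∀ c, 1 ≤ c → minkB H (P c) p = coeff ρ p p c := by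
    intro c hc
    have h1 := hP c hc p hps 1
    rwa [map_one, one_apply, coshDisp_one, mul_one] at h1
  have hF1 : ∀ c, 0 < coeff ρ p p c := fun c => zero_lt_one.trans_le (one_le_coeff hp c)
  have hpow : ∀ {c : ℝ} (n : ℕ), 1 ≤ c → 1 ≤ c ^ n := fun n hc => one_le_pow₀ hc
  set F : ℕ → ℝ := fun n => coeff ρ p p (a ^ n) with hF
  have hFpos : ∀ n, 0 < F n := fun n => hF1 _
  have hlog : ∀ n, F n * F (n + 2) ≤ F (n + 1) ^ 2 := by
    intro n
    have hs : 1 ≤ √a := Real.one_le_sqrt.2 ha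
    have hsq : √a * √a = a := Real.mul_self_sqrt (by linarith)
    have h := minkB_mul_minkB_le_sq (P (√a ^ n)) (y := P (√a ^ (n + 2)))
      (by rw [hPb _ _ (hpow _ hs) (hpow _ hs)]; exact hF1 _)
    rw [hPb _ _ (hpow _ hs) (hpow _ hs), hPb _ _ (hpow _ hs) (hpow _ hs),
      hPb _ _ (hpow _ hs) (hpow _ hs), ← mul_pow, ← mul_pow, hsq] at h
    have h2 : √a ^ n * √a ^ (n + 2) = a ^ (n + 1) := by
      have h3 : a ^ (n + 1) = (√a * √a) ^ (n + 1) := by rw [hsq]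
      rw [h3]; ring
    rwa [h2] at h
  have hanti := antitone_add_div_mul hFpos hlog
  set z : ℕ → ℝ × H := fun n => (F n)⁻¹ • P (a ^ n) with hz
  have hzs : ∀ n, IsSpherical ρ (z n) := fun n => (hPs _ (hpow n ha)).smul _
  have hzp : ∀ n, minkB H (z n) p = 1 := fun n => by
    rw [hz, minkB_smul_left, hPp _ (hpow n ha)]
    exact inv_mul_cancel₀ (hFpos n).ne'
  have hzz : ∀ n m, minkB H (z n) (z m) = F (n + m) / (F n * F m) := fun n m => by
    rw [hz, minkB_smul_left, minkB_smul_right, hPb _ _ (hpow n ha) (hpow m ha), ← pow_add]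
    show (F n)⁻¹ * ((F m)⁻¹ * F (n + m)) = _
    field_simp
  have hzanti : ∀ {N n m : ℕ}, N ≤ n → N ≤ m → minkB H (z n) (z m) ≤ minkB H (z N) (z N) := by
    intro N n m hn hm
    calc minkB H (z n) (z m) ≤ minkB H (z N) (z m) := by
          rw [hzz, hzz]; exact hanti m hn
      _ = minkB H (z m) (z N) := minkB_comm _ _
      _ ≤ minkB H (z N) (z N) := by
          rw [hzz, hzz]; exact hanti N hm
  have hdiag : Antitone fun n => minkB H (z n) (z n) := fun n m h => hzanti h h
  have hdiag0 : BddBelow (Set.range fun n => minkB H (z n) (z n)) := by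
    refine ⟨0, ?_⟩
    rintro _ ⟨n, rfl⟩
    simp only [hzz]
    have := hFpos n
    have := hFpos (n + n)
    positivity
  set L := ⨅ n, minkB H (z n) (z n)
  have hL : ∀ n, L ≤ minkB H (z n) (z n) := ciInf_le hdiag0
  have hlim := tendsto_atTop_ciInf hdiag hdiag0
  obtain ⟨C, hC⟩ := exists_norm_sq_le hp
  have hCpos : 0 ≤ C := by
    have h1 := (sq_nonneg ‖p‖).trans (hC p)
    rw [hp.1] at h1
    linarith
  have hcauchy : CauchySeq z := by
    refine cauchySeq_of_le_tendsto_0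
      (fun N => √(C * (2 * (minkB H (z N) (z N) - L)))) (fun n m N hn hm => ?_) ?_
    · rw [dist_eq_norm]
      refine Real.le_sqrt_of_sq_le ((hC _).trans ?_)
      refine mul_le_mul_of_nonneg_left ?_ hCpos
      rw [minkB_sub_left (z n) (z m) p, hzp, hzp, minkB_sub_left, minkB_sub_right, minkB_sub_right,
        minkB_comm (z m) (z n)]
      linarith [hL n, hL m, hzanti hn hm]
    · have h : Filter.Tendsto _ _ (nhds √(C * (2 * (L - L)))) :=
        (((hlim.sub_const L).const_mul 2).const_mul C).sqrt
      rwa [sub_self, mul_zero, mul_zero, Real.sqrt_zero] at h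
  obtain ⟨y, hy⟩ := cauchySeq_tendsto_of_complete hcauchy
  have hr : Antitone fun n => F (n + 1) / F n := antitone_nat_of_succ_le fun n => by
    rw [div_le_div_iff₀ (hFpos _) (hFpos _)]
    linarith [hlog n]
  have hr0 : BddBelow (Set.range fun n => F (n + 1) / F n) := by
    refine ⟨0, ?_⟩
    rintro _ ⟨n, rfl⟩
    exact (div_pos (hFpos _) (hFpos _)).le
  have hrlim := tendsto_atTop_ciInf hr hr0
  refine ⟨y, isClosed_isSpherical.mem_of_tendsto hy (Filter.Eventually.of_forall hzs),
    tendsto_nhds_unique (hy.minkB tendsto_const_nhds) (by simp [hzp]),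
    ⨅ n, F (n + 1) / F n, fun b hb => ?_⟩
  refine tendsto_nhds_unique (hy.minkB tendsto_const_nhds) ?_
  refine (hrlim.mul ((hy.comp (Filter.tendsto_add_atTop_nat 1)).minkB tendsto_const_nhds)).congr
    fun n => ?_
  have hab : 1 ≤ a * b := one_le_mul_of_one_le_of_one_le ha hb
  simp only [Function.comp, hz, minkB_smul_left, hPb _ _ (hpow _ ha) hb, hPb _ _ (hpow _ ha) hab]
  rw [← mul_assoc (a ^ n), ← pow_succ]
  have := (hFpos n).ne'
  have := (hFpos (n + 1)).ne'
  field_simp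

/-- Spherical vectors are multiples of `p`, and the spherical coefficient is multiplicative. -/
theorem isSpherical_eq_smul_and_coeff_mul [CompleteSpace H] (hinf : ¬ FiniteDimensional ℝ H)
    [Nontrivial H] (hirr : IsIrreducible ρ) {p : ℝ × H} (hp : p ∈ Hyp H)
    (hps : IsSpherical ρ p) : (∀ z, IsSpherical ρ z → z = minkB H p z • p) ∧
      ∀ a b, 1 ≤ a → 1 ≤ b → coeff ρ p p (a * b) = coeff ρ p p a * coeff ρ p p b := by
  have hex : ∀ a : ℝ, ∃ w, 1 ≤ a → IsSpherical ρ w ∧ ∀ z, IsSpherical ρ z → ∀ g,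
      minkB H w ((ρ g).1 z) = coeff ρ p z (a * coshDisp g) := fun a => by
    by_cases ha : 1 ≤ a
    · obtain ⟨w, hw⟩ := exists_isSpherical_minkB_eq_coeff hinf hirr hp hps ha
      exact ⟨w, fun _ => hw⟩
    · exact ⟨0, fun h => absurd h ha⟩
  choose P hPP using hex
  have hPs := fun a ha => (hPP a ha).1
  have hP := fun a ha => (hPP a ha).2
  have key : ∀ a, 1 ≤ a → ∃ l : ℝ, ∀ v b, 1 ≤ b →
      minkB H v (P (a * b)) = l * minkB H v (P b) := by
    intro a ha
    obtain ⟨z, hzs, hzp, l, hl⟩ := exists_isSpherical_eigenvector hp hps hPs hP ha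
    refine ⟨l, ?_⟩
    let N : Submodule ℝ (ℝ × H) :=
      { carrier := {v | ∀ g b, 1 ≤ b →
          minkB H ((ρ g).1 v) (P (a * b)) = l * minkB H ((ρ g).1 v) (P b)}
        add_mem' := fun {u v} hu hv g b hb => by
          rw [map_add, minkB_add_left, minkB_add_left, hu g b hb, hv g b hb, mul_add]
        zero_mem' := fun g b hb => by simp [minkB_zero_left]
        smul_mem' := fun c v hv g b hb => by
          rw [map_smul, minkB_smul_left, minkB_smul_left, hv g b hb, mul_left_comm] }
    have hNc : IsClosed (N : Set (ℝ × H)) := by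
      show IsClosed {v | ∀ g b, 1 ≤ b →
          minkB H ((ρ g).1 v) (P (a * b)) = l * minkB H ((ρ g).1 v) (P b)}
      simp only [Set.ofPred_forall]
      exact isClosed_iInter fun g => isClosed_iInter fun b => isClosed_iInter fun _ =>
        isClosed_eq ((ρ g).1.continuous.minkB continuous_const)
          (((ρ g).1.continuous.minkB continuous_const).const_mul l)
    have hzN : z ∈ N := by
      intro g b hb
      have hab : 1 ≤ a * b := one_le_mul_of_one_le_of_one_le ha hb
      have hc := one_le_coshDisp g
      have h1 : ∀ c, 1 ≤ c → coeff ρ p z c = minkB H z (P c) := fun c hc => by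
        rw [minkB_comm, ← mul_one c, ← coshDisp_one (H := H), ← hP c hc z hzs 1, map_one, one_apply,
          coshDisp_one, mul_one]
      rw [minkB_comm, hP _ hab z hzs, minkB_comm, hP _ hb z hzs, mul_assoc,
        h1 _ (one_le_mul_of_one_le_of_one_le ha (one_le_mul_of_one_le_of_one_le hb hc)),
        h1 _ (one_le_mul_of_one_le_of_one_le hb hc), hl _ (one_le_mul_of_one_le_of_one_le hb hc)]
    have hN : N = ⊤ := by
      refine (hirr N hNc fun g v hv h b hb => ?_).resolve_left fun h => ?_
      · rw [← mul_apply, ← map_mul]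
        exact hv _ b hb
      · rw [h, Submodule.mem_bot] at hzN
        rw [hzN, minkB_zero_left] at hzp
        exact zero_ne_one hzp
    intro v b hb
    have hv : v ∈ N := by rw [hN]; trivial
    have h1 := hv 1 b hb
    rwa [map_one, one_apply] at h1
  have hP1 : P 1 = p := by
    rw [← sub_eq_zero]
    refine eq_zero_of_forall_minkB_eq_zero hirr hp fun g => ?_
    rw [minkB_sub_left, hP 1 le_rfl p hps, one_mul, minkB_comm p, hps.minkB_eq_coeff hps, sub_self]
  have hPp : ∀ c, 1 ≤ c → minkB H p (P c) = coeff ρ p p c := by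
    intro c hc
    have h1 := hP c hc p hps 1
    rwa [map_one, one_apply, coshDisp_one, mul_one, minkB_comm] at h1
  have hmul : ∀ a, 1 ≤ a → ∀ v b, 1 ≤ b →
      minkB H v (P (a * b)) = coeff ρ p p a * minkB H v (P b) := by
    intro a ha
    obtain ⟨l, hl⟩ := key a ha
    have h1 := hl p 1 le_rfl
    rw [hP1, mul_one, hPp a ha, hp.1, mul_one] at h1
    rwa [h1]
  refine ⟨fun z hz => ?_, fun a b ha hb => ?_⟩
  · rw [← sub_eq_zero]
    refine eq_zero_of_forall_minkB_eq_zero hirr hp fun g => ?_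
    have hc := one_le_coshDisp g
    have h1 := hmul _ hc z 1 le_rfl
    have h2 := hP _ hc z hz 1
    rw [map_one, one_apply, coshDisp_one, mul_one, ← hps.minkB_eq_coeff hz] at h2
    rw [hP1, mul_one, minkB_comm, h2, ← hps.minkB_eq_coeff hps] at h1
    rw [minkB_sub_left, minkB_smul_left, minkB_comm z, minkB_comm p ((ρ g).1 p), h1,
      minkB_comm z, mul_comm, sub_self]
  · rw [← hPp _ (one_le_mul_of_one_le_of_one_le ha hb), hmul a ha p b hb, hPp b hb]

end Oplus

end Multiplicativity

section Exponent

/-- A multiplicative function `[1, ∞) → [1, ∞)` is a power function. -/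
theorem exists_eq_rpow_of_multiplicative {F : ℝ → ℝ} (h1 : ∀ a, 1 ≤ a → 1 ≤ F a)
    (hmul : ∀ a b, 1 ≤ a → 1 ≤ b → F (a * b) = F a * F b) :
    ∃ t : ℝ, 0 ≤ t ∧ ∀ a, 1 ≤ a → F a = a ^ t := by
  set G : ℝ → ℝ := fun x => Real.log (F (Real.exp x)) with hG
  have hexp : ∀ {x : ℝ}, 0 ≤ x → 1 ≤ Real.exp x := fun hx => Real.one_le_exp hx
  have hG0 : ∀ x, 0 ≤ x → 0 ≤ G x := fun x hx => Real.log_nonneg (h1 _ (hexp hx))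
  have hadd : ∀ x y, 0 ≤ x → 0 ≤ y → G (x + y) = G x + G y := fun x y hx hy => by
    have h2 := h1 _ (hexp hx)
    have h3 := h1 _ (hexp hy)
    simp only [hG]
    rw [Real.exp_add, hmul _ _ (hexp hx) (hexp hy), Real.log_mul (by linarith) (by linarith)]
  have hmono : ∀ x y, 0 ≤ x → x ≤ y → G x ≤ G y := fun x y hx hxy => by
    have h2 := hadd x (y - x) hx (by linarith)
    rw [add_sub_cancel] at h2
    linarith [hG0 (y - x) (by linarith)]
  have hnat : ∀ (n : ℕ) x, 0 ≤ x → G (n * x) = n * G x := fun n x hx => by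
    induction n with
    | zero =>
      have h2 := hadd 0 0 le_rfl le_rfl
      rw [add_zero] at h2
      rw [Nat.cast_zero, zero_mul, zero_mul]
      linarith
    | succ n ih =>
      rw [Nat.cast_succ, add_mul, one_mul, hadd _ _ (by positivity) hx, ih]
      ring
  have hlin : ∀ x, 0 ≤ x → G x = x * G 1 := by
    intro x hx
    have hbound : ∀ n : ℕ, n * |G x - x * G 1| ≤ G 1 := by
      intro n
      have hnx : 0 ≤ n * x := by positivity
      have hk1 := Nat.floor_le hnx
      have hk2 := (Nat.lt_floor_add_one (n * x)).le
      set k := ⌊n * x⌋₊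
      have e1 := hmono _ _ (by positivity) hk1
      have e2 := hmono _ _ hnx hk2
      have e3 := hnat k 1 zero_le_one
      have e4 := hnat (k + 1) 1 zero_le_one
      rw [mul_one] at e3 e4
      push_cast at e4
      rw [hnat n x hx] at e1 e2
      rw [e3] at e1
      rw [e4] at e2
      have hg := hG0 1 zero_le_one
      have f1 := mul_le_mul_of_nonneg_right hk1 hg
      have f2 := mul_le_mul_of_nonneg_right hk2 hg
      rw [← abs_of_nonneg (n.cast_nonneg (α := ℝ)), ← abs_mul, abs_le]
      constructor <;> nlinarith
    by_contra hne
    have hpos : 0 < |G x - x * G 1| := abs_pos.2 (sub_ne_zero.2 hne)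
    obtain ⟨n, hn⟩ := exists_nat_gt (G 1 / |G x - x * G 1|)
    rw [div_lt_iff₀ hpos] at hn
    linarith [hbound n]
  refine ⟨G 1, hG0 1 zero_le_one, fun a ha => ?_⟩
  have h2 := hlin (Real.log a) (Real.log_nonneg ha)
  simp only [hG] at h2
  rw [Real.exp_log (by linarith)] at h2
  rw [Real.rpow_def_of_pos (by linarith), ← h2, Real.exp_log (by linarith [h1 a ha])]

variable {H}

theorem eq_of_minkB_eq_one {x p : ℝ × H} (hx : x ∈ Hyp H) (hp : p ∈ Hyp H)
    (h : minkB H x p = 1) : x = p := by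
  obtain ⟨C, hC⟩ := Oplus.exists_norm_sq_le hp
  have h1 := hC (x - p)
  have h2 : C * (2 * minkB H (x - p) p ^ 2 - minkB H (x - p) (x - p)) = 0 := by
    rw [minkB_sub_left, minkB_sub_left, minkB_sub_right, minkB_sub_right, hp.1, hx.1, h,
      minkB_comm p x, h]
    ring
  rw [h2] at h1
  have h3 : ‖x - p‖ = 0 := by nlinarith [norm_nonneg (x - p)]
  exact sub_eq_zero.1 (norm_eq_zero.1 h3)

namespace Oplus

variable {ρ : Oplus H →* Oplus H}

theorem IsIrreducible.exists_apply_ne (hinf : ¬ FiniteDimensional ℝ H) (hirr : IsIrreducible ρ)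
    {p : ℝ × H} (hp : p ∈ Hyp H) : ∃ g, (ρ g).1 p ≠ p := by
  by_contra! h
  rcases hirr (ℝ ∙ p) (Submodule.closed_of_finiteDimensional _) (fun g v hv => by
    obtain ⟨c, rfl⟩ := Submodule.mem_span_singleton.1 hv
    rw [map_smul, h g]
    exact hv) with h1 | h1
  · rw [Submodule.span_singleton_eq_bot] at h1
    have h2 := hp.2
    rw [h1] at h2
    exact lt_irrefl _ h2
  · have h2 : Module.Finite ℝ (⊤ : Submodule ℝ (ℝ × H)) := by
      rw [← h1]; infer_instance
    have h3 : Module.Finite ℝ (ℝ × H) := Module.Finite.equiv (Submodule.topEquiv (R := ℝ))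
    exact hinf (Module.Finite.of_surjective (LinearMap.snd ℝ ℝ H) LinearMap.snd_surjective)

/-- The exponent of a spherical coefficient that is a power function is at most one. -/
theorem exponent_le_one [Nontrivial H] {p : ℝ × H} (hp : p ∈ Hyp H) (hps : IsSpherical ρ p)
    {t : ℝ} (ht : ∀ a, 1 ≤ a → coeff ρ p p a = a ^ t) : t ≤ 1 := by
  by_contra! h1t
  have hs : (1 : ℝ) ≤ √2 := Real.one_le_sqrt.2 (by norm_num)
  have hss : √2 ^ 2 = (2 : ℝ) := Real.sq_sqrt (by norm_num)
  obtain ⟨e, he⟩ := exists_norm_eq H zero_le_one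
  obtain ⟨g, hg⟩ := exists_apply_eq_polarPoint hs he
  obtain ⟨g', hg'⟩ := exists_apply_eq_polarPoint hs (e := -e) (by rwa [norm_neg])
  have hb : minkB H (g.1 (hypBase H)) (g'.1 (hypBase H)) = 3 := by
    rw [hg, hg', minkB, polarPoint, polarPoint, real_inner_smul_left, real_inner_smul_right,
      inner_neg_right, real_inner_self_eq_norm_sq, he, hss, ← pow_two, hss]
    norm_num
  have hd : coshDisp g = √2 := by rw [coshDisp, hg]; rfl
  have hd' : coshDisp g' = √2 := by rw [coshDisp, hg']; rfl
  have h := minkB_self_le_sq hp ((ρ g).1 p + (ρ g').1 p)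
  have hsqrt : ((√2 : ℝ) ^ t) ^ 2 = 2 ^ t := by
    rw [Real.rpow_pow_comm (by positivity), hss]
  rw [minkB_add_left, minkB_add_left, minkB_add_right, minkB_add_right, minkB_map, minkB_map, hp.1,
    minkB_comm ((ρ g').1 p) ((ρ g).1 p), hps.minkB_map_map_eq_coeff hps, hb,
    hps.minkB_eq_coeff hps, hps.minkB_eq_coeff hps, hd, hd', ht _ hs, ht 3 (by norm_num)] at h
  have hconv := (strictConvexOn_rpow h1t).2 (Set.mem_Ici.2 (zero_le_one (α := ℝ)))
    (Set.mem_Ici.2 (by norm_num : (0 : ℝ) ≤ 3)) (by norm_num) (by norm_num : (0 : ℝ) < 1 / 2)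
    (by norm_num : (0 : ℝ) < 1 / 2) (by norm_num)
  norm_num at hconv
  nlinarith

end Oplus

end Exponent

/-- classification: every irreducible self-representation of `O₊(B)`
(no continuity assumed) is, at the fixed point of the stabilizer of `p₀ = (1,0)`,
given by the `t`-th power of the tautological kernel for a unique `0 < t ≤ 1`. -/
theorem classification_of_irreducible_self_representations
    (H : Type*) [NormedAddCommGroup H] [InnerProductSpace ℝ H] [CompleteSpace H]
    [TopologicalSpace.SeparableSpace H] (hinf : ¬ FiniteDimensional ℝ H)
    (ρ : Oplus H →* Oplus H)
    (hirr : ∀ N : Submodule ℝ (ℝ × H), IsClosed (N : Set (ℝ × H)) →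
      (∀ g : Oplus H, ∀ v ∈ N, (ρ g).1 v ∈ N) → N = ⊥ ∨ N = ⊤) :
    ∃! t : ℝ, (0 < t ∧ t ≤ 1) ∧
      ∃ p ∈ Hyp H, ∀ g h : Oplus H,
        minkB H ((ρ g).1 p) ((ρ h).1 p) =
          (minkB H (g.1 ((1 : ℝ), (0 : H))) (h.1 ((1 : ℝ), (0 : H)))) ^ t := by
  have hH : Nontrivial H := by
    by_contra h
    rw [not_nontrivial_iff_subsingleton] at h
    exact hinf inferInstance
  have hirr' : Oplus.IsIrreducible ρ := hirr
  obtain ⟨p, hp, hfix⟩ := Oplus.exists_fixed_point_orthogonal hinf (ρ.comp (Oplus.ofOrthogonal H))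
  have hps : Oplus.IsSpherical ρ p := fun k hk => by
    obtain ⟨k, rfl⟩ := Oplus.exists_ofOrthogonal_eq hk
    exact hfix k
  obtain ⟨hunique, hmul⟩ := Oplus.isSpherical_eq_smul_and_coeff_mul hinf hirr' hp hps
  obtain ⟨t, ht0, ht⟩ := exists_eq_rpow_of_multiplicative
    (fun a _ => Oplus.one_le_coeff (ρ := ρ) hp a) hmul
  have hkernel : ∀ g h : Oplus H, minkB H ((ρ g).1 p) ((ρ h).1 p) =
      (minkB H (g.1 (hypBase H)) (h.1 (hypBase H))) ^ t := fun g h => by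
    rw [hps.minkB_map_map_eq_coeff hps,
      ht _ (one_le_minkB (Oplus.map_mem g hypBase_mem) (Oplus.map_mem h hypBase_mem))]
  refine ⟨t, ⟨⟨lt_of_le_of_ne ht0 fun h0 => ?_, Oplus.exponent_le_one hp hps ht⟩, p, hp, hkernel⟩,
    ?_⟩
  · obtain ⟨g, hg⟩ := hirr'.exists_apply_ne hinf hp
    refine hg (eq_of_minkB_eq_one (Oplus.map_mem _ hp) hp ?_)
    rw [hps.minkB_eq_coeff hps, ht _ (Oplus.one_le_coshDisp g), ← h0, Real.rpow_zero]
  · rintro t' ⟨-, p', hp', hkernel'⟩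
    have hps' : Oplus.IsSpherical ρ p' := fun k hk => by
      refine eq_of_minkB_eq_one (Oplus.map_mem _ hp') hp' ?_
      have h := hkernel' k 1
      rwa [map_one, Oplus.one_apply, Oplus.one_apply, hk, (hypBase_mem (H := H)).1,
        Real.one_rpow] at h
    have hpp' : p' = p := by
      have h1 := hunique p' hps'
      have h2 := hp'.1
      have h3 := one_le_minkB hp hp'
      rw [h1, minkB_smul_left, minkB_smul_right, hp.1, mul_one] at h2
      have h4 : minkB H p p' = 1 := by nlinarith
      rw [h1, h4, one_smul]
    subst hpp'
    have h1 := hkernel (Oplus.ofCosh H 2) 1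
    have h2 := hkernel' (Oplus.ofCosh H 2) 1
    rw [h1, Oplus.one_apply, ← Oplus.coshDisp_eq, Oplus.coshDisp_ofCosh (by norm_num)] at h2
    exact ((Real.rpow_right_inj (by norm_num) (by norm_num)).1 h2).symm
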